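/- arXiv:1106.0877 — 2 statements merged into one kernel-verified Lean document; each statement's English description precedes it below -/
import Mathlib

section
/- Let (X,d) be a complete separable metric space in which closed balls are compact, let α be a Young function satisfying the Δ₂-condition, and let μ be a probability measure on X. If μ satisfies the (τ)-log-Sobolev inequality (τ)-LSI_α(1,A) for some A > 0, then μ satisfies the transport-entropy inequality T_α(C) with C = κ_{p_α}·max(A,1)^{p_α−1}, where κ_{p_α} = p_α^{p_α(p_α−1)} / (p_α−1)^{(p_α−1)²}. -/
open MeasureTheory Filter Set Topology
open scoped ENNReal NNReal

noncomputable section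

/-- The right derivative of a function `α : ℝ → ℝ`. -/
def rightD (α : ℝ → ℝ) (x : ℝ) : ℝ := derivWithin α (Set.Ioi x) x

/-- The left derivative of a function `α : ℝ → ℝ`. -/
def leftD (α : ℝ → ℝ) (x : ℝ) : ℝ := derivWithin α (Set.Iio x) x

/-- A Young function: an even, convex, nonnegative function, increasing on `[0,∞)`,
vanishing at `0` and with vanishing right derivative at `0`. -/
structure IsYoung (α : ℝ → ℝ) : Prop where
  nonneg : ∀ x, 0 ≤ α x
  even : ∀ x, α (-x) = α x
  convex : ConvexOn ℝ Set.univ α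
  mono : StrictMonoOn α (Set.Ici 0)
  zero : α 0 = 0
  rightD_zero : rightD α 0 = 0

/-- The Δ₂-condition for a Young function. -/
def DeltaTwo (α : ℝ → ℝ) : Prop := ∃ K > 0, ∀ x : ℝ, α (2 * x) ≤ K * α x

/-- `r_α = inf_{x>0} x α'₋(x)/α(x)`. -/
def rAlpha (α : ℝ → ℝ) : ℝ := sInf {r : ℝ | ∃ x > 0, r = x * leftD α x / α x}

/-- `p_α = sup_{x>0} x α'₊(x)/α(x)`. -/
def pAlpha (α : ℝ → ℝ) : ℝ := sSup {r : ℝ | ∃ x > 0, r = x * rightD α x / α x}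

/-- The Fenchel-Legendre transform `α*(y) = sup_x {xy - α(x)}`, with values in `[0,∞]`. -/
def legendre (α : ℝ → ℝ) (y : ℝ) : ℝ≥0∞ := ⨆ x : ℝ, ENNReal.ofReal (x * y - α x)

/-- `ξ_α(t) = sup_{u>0} α*(t α'₊(u)) / (t α(u))`. -/
def xiAlpha (α : ℝ → ℝ) (t : ℝ) : ℝ≥0∞ :=
  ⨆ u : {u : ℝ // 0 < u}, legendre α (t * rightD α u) / ENNReal.ofReal (t * α u)

/-- A bounded real-valued function. -/
def IsBoundedFun {Y : Type*} (f : Y → ℝ) : Prop := ∃ M, ∀ x, |f x| ≤ M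

variable {X : Type*} [MetricSpace X] [MeasurableSpace X]

/-- The optimal transport cost `T_α(ν,μ)` between two measures, for the cost
function `(x,y) ↦ α(d(x,y))`. -/
def transportCost (α : ℝ → ℝ) (ν μ : Measure X) : ℝ≥0∞ :=
  sInf { c : ℝ≥0∞ | ∃ π : Measure (X × X), π.map Prod.fst = ν ∧ π.map Prod.snd = μ ∧
      c = ∫⁻ z, ENNReal.ofReal (α (dist z.1 z.2)) ∂π }

open Classical in
/-- The relative entropy `H(ν|μ) = ∫ log (dν/dμ) dν` if `ν ≪ μ` (and `+∞` if `ν` is not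
absolutely continuous with respect to `μ`, or if the integral diverges). -/
def relEnt (ν μ : Measure X) : ℝ≥0∞ :=
  if ν ≪ μ ∧ Integrable (fun x => Real.log (ν.rnDeriv μ x).toReal) ν
  then ENNReal.ofReal (∫ x, Real.log (ν.rnDeriv μ x).toReal ∂ν) else ⊤

/-- The transport-entropy inequality `T_α(C)`: for every probability measure `ν`,
`T_α(ν,μ) ≤ C H(ν|μ)`. -/
def TransportEntropy (μ : Measure X) (α : ℝ → ℝ) (C : ℝ) : Prop :=
  ∀ ν : Measure X, IsProbabilityMeasure ν →
    transportCost α ν μ ≤ ENNReal.ofReal C * relEnt ν μ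

/-- The entropy functional `Ent_μ(e^f)`. -/
def entExp (μ : Measure X) (f : X → ℝ) : ℝ :=
  ∫ x, Real.exp (f x) * Real.log (Real.exp (f x)) ∂μ
    - (∫ x, Real.exp (f x) ∂μ) * Real.log (∫ x, Real.exp (f x) ∂μ)

/-- `|∇⁺ f|(x) = limsup_{y → x} [f(y) - f(x)]₊ / d(y,x)` (equal to `0` at isolated
points by the conventions on `limsup` and `sInf` in `ℝ`). -/
def gradPlus (f : X → ℝ) (x : X) : ℝ :=
  limsup (fun y => max (f y - f x) 0 / dist y x) (𝓝[≠] x)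

/-- `|∇⁻ f|(x) = limsup_{y → x} [f(y) - f(x)]₋ / d(y,x)` (equal to `0` at isolated
points by the conventions on `limsup` and `sInf` in `ℝ`). -/
def gradMinus (f : X → ℝ) (x : X) : ℝ :=
  limsup (fun y => max (-(f y - f x)) 0 / dist y x) (𝓝[≠] x)

/-- The modified log-Sobolev inequality plus `LSI⁺_α(A)`. -/
def LSIplus (μ : Measure X) (α : ℝ → ℝ) (A : ℝ) : Prop :=
  ∀ f : X → ℝ, IsBoundedFun f → LocallyLipschitz f →
    ENNReal.ofReal (entExp μ f) ≤
      ENNReal.ofReal A * ∫⁻ x, legendre α (gradPlus f x) * ENNReal.ofReal (Real.exp (f x)) ∂μ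

/-- The modified log-Sobolev inequality minus `LSI⁻_α(A)`. -/
def LSIminus (μ : Measure X) (α : ℝ → ℝ) (A : ℝ) : Prop :=
  ∀ f : X → ℝ, IsBoundedFun f → LocallyLipschitz f →
    ENNReal.ofReal (entExp μ f) ≤
      ENNReal.ofReal A * ∫⁻ x, legendre α (gradMinus f x) * ENNReal.ofReal (Real.exp (f x)) ∂μ

/-- The inf-convolution operator `Q_α^λ f(x) = inf_y {f(y) + λ α(d(x,y))}`. -/
def QInf (α : ℝ → ℝ) (lam : ℝ) (f : X → ℝ) (x : X) : ℝ :=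
  ⨅ y : X, (f y + lam * α (dist x y))

/-- The `(τ)`-log-Sobolev inequality `(τ)-LSI_α(λ, A)`. -/
def TauLSI (μ : Measure X) (α : ℝ → ℝ) (lam A : ℝ) : Prop :=
  ∀ f : X → ℝ, IsBoundedFun f → LocallyLipschitz f →
    entExp μ f ≤ A * ∫ x, (f x - QInf α lam f x) * Real.exp (f x) ∂μ

/-- The `n`-dimensional inf-convolution operator
`Q_{α,n} f(x) = inf_y {f(y) + Σᵢ α(d(xᵢ,yᵢ))}`. -/
def QInfN (α : ℝ → ℝ) {n : ℕ} (f : (Fin n → X) → ℝ) (x : Fin n → X) : ℝ :=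
  ⨅ y : Fin n → X, (f y + ∑ i, α (dist (x i) (y i)))

/-- The `n`-dimensional sup-convolution operator
`P_{α,n} f(x) = sup_y {f(y) - Σᵢ α(d(xᵢ,yᵢ))}`. -/
def PSupN (α : ℝ → ℝ) {n : ℕ} (f : (Fin n → X) → ℝ) (x : Fin n → X) : ℝ :=
  ⨆ y : Fin n → X, (f y - ∑ i, α (dist (x i) (y i)))

end

namespace IsYoung

variable {α : ℝ → ℝ}

lemma pos (hα : IsYoung α) {x : ℝ} (hx : 0 < x) : 0 < α x := by
  have h := hα.mono (mem_Ici.2 le_rfl) (mem_Ici.2 hx.le) hx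
  rwa [hα.zero] at h

lemma continuous (hα : IsYoung α) : Continuous α :=
  continuousOn_univ.1 (hα.convex.continuousOn isOpen_univ)

lemma le_of_le (hα : IsYoung α) {x y : ℝ} (hx : 0 ≤ x) (hxy : x ≤ y) : α x ≤ α y :=
  hα.mono.monotoneOn hx (hx.trans hxy) hxy

lemma hasDerivWithinAt_rightD (hα : IsYoung α) (x : ℝ) :
    HasDerivWithinAt α (rightD α x) (Ioi x) x :=
  hα.convex.hasDerivWithinAt_rightDeriv_of_mem_interior (by simp)

lemma mul_rightD_le (hα : IsYoung α) {x : ℝ} (hx : 0 < x) :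
    x * rightD α x ≤ α (2 * x) - α x := by
  have h := hα.convex.rightDeriv_le_slope (mem_univ x) (mem_univ (2 * x)) (by linarith)
    (hα.hasDerivWithinAt_rightD x).differentiableWithinAt
  rw [slope_def_field, le_div_iff₀ (by linarith)] at h
  calc x * rightD α x = derivWithin α (Ioi x) x * (2 * x - x) := by rw [rightD]; ring
    _ ≤ _ := h

lemma mul_rightD_le_pAlpha_mul (hα : IsYoung α) (hΔ : DeltaTwo α) {x : ℝ} (hx : 0 < x) :
    x * rightD α x ≤ pAlpha α * α x := by
  obtain ⟨K, -, hK⟩ := hΔ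
  rw [← div_le_iff₀ (hα.pos hx)]
  refine le_csSup ⟨K - 1, ?_⟩ ⟨x, hx, rfl⟩
  rintro r ⟨y, hy, rfl⟩
  rw [div_le_iff₀ (hα.pos hy)]
  linarith [hα.mul_rightD_le hy, hK y]

/-- The exponent `p_α` controls the growth of `α` under dilations. -/
lemma apply_mul_le (hα : IsYoung α) (hΔ : DeltaTwo α) {t x : ℝ} (ht : 1 ≤ t) (hx : 0 ≤ x) :
    α (t * x) ≤ t ^ pAlpha α * α x := by
  rcases hx.eq_or_lt with rfl | hx
  · simp [hα.zero]
  have htx : x ≤ t * x := le_mul_of_one_le_left hx.le ht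
  have hpos : ∀ y ∈ Icc x (t * x), 0 < y := fun y hy => hx.trans_le hy.1
  have key := image_le_of_deriv_right_le_deriv_boundary
    (f := fun y => Real.log (α y)) (f' := fun y => rightD α y / α y)
    (B := fun y => pAlpha α * Real.log y + (Real.log (α x) - pAlpha α * Real.log x))
    (B' := fun y => pAlpha α * y⁻¹) (a := x) (b := t * x)
    (hα.continuous.continuousOn.log fun y hy => (hα.pos (hpos y hy)).ne')
    (fun y hy => ((hα.hasDerivWithinAt_rightD y).Ici_of_Ioi).log
      (hα.pos (hpos y ⟨hy.1, hy.2.le⟩)).ne')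
    (by simp)
    (((continuousOn_id.log fun y hy => (hpos y hy).ne').const_mul _).add_const _)
    (fun y hy => (((Real.hasDerivAt_log (hpos y ⟨hy.1, hy.2.le⟩).ne').const_mul
      (pAlpha α)).add_const _).hasDerivWithinAt)
    (fun y hy => by
      have hy0 := hpos y ⟨hy.1, hy.2.le⟩
      rw [div_le_iff₀ (hα.pos hy0), ← div_eq_mul_inv, div_mul_eq_mul_div, le_div_iff₀ hy0]
      linarith [hα.mul_rightD_le_pAlpha_mul hΔ hy0])
    (right_mem_Icc.2 htx)
  have ht0 : 0 < t := by linarith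
  simp only [Real.log_mul ht0.ne' hx.ne'] at key
  rw [← Real.log_le_log_iff (hα.pos (mul_pos ht0 hx))
    (mul_pos (Real.rpow_pos_of_pos ht0 _) (hα.pos hx)),
    Real.log_mul (Real.rpow_pos_of_pos ht0 _).ne' (hα.pos hx).ne', Real.log_rpow ht0]
  linarith

lemma one_lt_pAlpha (hα : IsYoung α) (hΔ : DeltaTwo α) : 1 < pAlpha α := by
  by_contra! hp
  have h0 := hα.hasDerivWithinAt_rightD 0
  rw [hα.rightD_zero, hasDerivWithinAt_iff_tendsto_slope' (by simp)] at h0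
  have h1 : 0 < α 1 := hα.pos one_pos
  obtain ⟨y, hy, hy0, hy1⟩ := ((h0.eventually (gt_mem_nhds h1)).and
    (Ioo_mem_nhdsGT (zero_lt_one' ℝ))).exists
  rw [slope_def_field, hα.zero, sub_zero, sub_zero, div_lt_iff₀ hy0] at hy
  have hy' : 1 ≤ y⁻¹ := (one_le_inv₀ hy0).2 hy1.le
  have h2 := hα.apply_mul_le hΔ hy' hy0.le
  rw [inv_mul_cancel₀ hy0.ne'] at h2
  have h3 : y⁻¹ ^ pAlpha α ≤ y⁻¹ := by
    simpa using Real.rpow_le_rpow_of_exponent_le hy' hp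
  have h4 : α 1 ≤ y⁻¹ * α y := h2.trans (mul_le_mul_of_nonneg_right h3 (hα.nonneg y))
  rw [inv_mul_eq_div, le_div_iff₀ hy0] at h4
  linarith

/-- A weighted quasi-triangle inequality for Young functions. -/
lemma apply_add_le (hα : IsYoung α) (hΔ : DeltaTwo α) {w a b : ℝ} (hw : 0 < w) (hw1 : w < 1)
    (ha : 0 ≤ a) (hb : 0 ≤ b) :
    α (a + b) ≤ (1 - w) ^ (-(pAlpha α - 1)) * α a + w ^ (-(pAlpha α - 1)) * α b := by
  have scale : ∀ v c : ℝ, 0 < v → v ≤ 1 → 0 ≤ c →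
      v * α (v⁻¹ * c) ≤ v ^ (-(pAlpha α - 1)) * α c := by
    intro v c hv hv1 hc
    have h := mul_le_mul_of_nonneg_left
      (hα.apply_mul_le hΔ ((one_le_inv₀ hv).2 hv1) hc) hv.le
    refine h.trans_eq ?_
    rw [← mul_assoc, Real.inv_rpow hv.le, ← Real.rpow_neg hv.le]
    congr 1
    rw [show -(pAlpha α - 1) = 1 + -pAlpha α by ring, Real.rpow_add hv, Real.rpow_one]
  have hw' : 0 < 1 - w := by linarith
  have hc := hα.convex.2 (mem_univ ((1 - w)⁻¹ * a)) (mem_univ (w⁻¹ * b)) hw'.le hw.le (by ring)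
  simp only [smul_eq_mul, mul_inv_cancel_left₀ hw'.ne', mul_inv_cancel_left₀ hw.ne'] at hc
  linarith [scale _ a hw' (by linarith) ha, scale _ b hw hw1.le hb]

end IsYoung

/-- The sup-convolution operator `P_α^λ f(x) = sup_y {f(y) - λ α(d(x,y))}`. -/
noncomputable def supConv {X : Type*} [MetricSpace X] (α : ℝ → ℝ) (lam : ℝ) (f : X → ℝ) (x : X) :
    ℝ :=
  ⨆ y : X, (f y - lam * α (dist x y))

section SupConv

variable {X : Type*} [MetricSpace X] {α : ℝ → ℝ} {f : X → ℝ} {M lam : ℝ}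

lemma QInf_one_eq_neg_supConv [MeasurableSpace X] (α : ℝ → ℝ) (g : X → ℝ) (x : X) :
    QInf α 1 g x = -supConv α 1 (fun y => -g y) x := by
  have h := Real.mul_iSup_of_nonpos (r := -1) (by norm_num)
    (fun y : X => -g y - 1 * α (dist x y))
  rw [supConv, neg_eq_neg_one_mul, h, QInf]
  congr 1 with y
  ring

lemma le_supConv_of_bdd (hα : IsYoung α) (hf : ∀ x, |f x| ≤ M) (hlam : 0 ≤ lam) (x y : X) :
    f y - lam * α (dist x y) ≤ supConv α lam f x := by
  refine le_ciSup (f := fun y => f y - lam * α (dist x y)) ⟨M, ?_⟩ y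
  rintro _ ⟨z, rfl⟩
  have := mul_nonneg hlam (hα.nonneg (dist x z))
  linarith [le_of_abs_le (hf z)]

lemma le_supConv (hα : IsYoung α) (hf : ∀ x, |f x| ≤ M) (hlam : 0 ≤ lam) (x : X) :
    f x ≤ supConv α lam f x := by
  simpa [hα.zero] using le_supConv_of_bdd hα hf hlam x x

lemma supConv_le {B : ℝ} (x : X) (h : ∀ y, f y - lam * α (dist x y) ≤ B) :
    supConv α lam f x ≤ B :=
  have : Nonempty X := ⟨x⟩
  ciSup_le h

lemma abs_supConv_le (hα : IsYoung α) (hf : ∀ x, |f x| ≤ M) (hlam : 0 ≤ lam) (x : X) :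
    |supConv α lam f x| ≤ M := by
  refine abs_le.2 ⟨(neg_le_of_abs_le (hf x)).trans (le_supConv hα hf hlam x),
    supConv_le x fun y => ?_⟩
  have := mul_nonneg hlam (hα.nonneg (dist x y))
  linarith [le_of_abs_le (hf y)]

lemma exists_supConv_le_add (α : ℝ → ℝ) (lam : ℝ) (f : X → ℝ) (x : X) {ε : ℝ} (hε : 0 < ε) :
    ∃ y, supConv α lam f x ≤ f y - lam * α (dist x y) + ε := by
  have : Nonempty X := ⟨x⟩
  obtain ⟨y, hy⟩ := exists_lt_of_lt_ciSup (f := fun y => f y - lam * α (dist x y))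
    (show supConv α lam f x - ε < supConv α lam f x by linarith)
  exact ⟨y, by linarith⟩

lemma supConv_anti (hα : IsYoung α) (hf : ∀ x, |f x| ≤ M) {lam' : ℝ} (hlam : 0 ≤ lam)
    (h : lam ≤ lam') (x : X) : supConv α lam' f x ≤ supConv α lam f x := by
  refine supConv_le x fun y => le_trans ?_ (le_supConv_of_bdd hα hf hlam x y)
  have := mul_le_mul_of_nonneg_right h (hα.nonneg (dist x y))
  linarith

lemma supConv_sub_le (hα : IsYoung α) (hf : ∀ x, |f x| ≤ M) {lam' : ℝ} (hlam : 0 < lam)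
    (h : lam ≤ lam') (x : X) :
    supConv α lam f x - supConv α lam' f x ≤ (lam' - lam) * (2 * M / lam) := by
  have hd : 0 ≤ (lam' - lam) / lam := div_nonneg (by linarith) hlam.le
  refine le_of_forall_pos_le_add fun η hη => ?_
  have hc : 0 < (lam' - lam) / lam + 1 := by linarith
  obtain ⟨y, hy⟩ := exists_supConv_le_add α lam f x (div_pos hη hc)
  set ε := η / ((lam' - lam) / lam + 1) with hε
  have hεη : ε * ((lam' - lam) / lam + 1) = η := div_mul_cancel₀ _ hc.ne'
  have h1 := le_supConv_of_bdd hα hf (hlam.le.trans h) x y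
  have h2 : lam * α (dist x y) ≤ 2 * M + ε := by
    linarith [le_supConv hα hf hlam.le x, le_of_abs_le (hf y), neg_le_of_abs_le (hf x)]
  have h3 : (lam' - lam) * α (dist x y) ≤ (lam' - lam) / lam * (2 * M + ε) := by
    calc (lam' - lam) * α (dist x y) = (lam' - lam) / lam * (lam * α (dist x y)) := by
          field_simp
      _ ≤ _ := mul_le_mul_of_nonneg_left h2 hd
  have h4 : (lam' - lam) * (2 * M / lam) = (lam' - lam) / lam * (2 * M) := by ring
  rw [h4]
  linarith

lemma IsYoung.mul_le_apply (hα : IsYoung α) {t : ℝ} (ht : 1 ≤ t) : t * α 1 ≤ α t := by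
  have ht0 : 0 < t := by linarith
  have h := hα.convex.2 (mem_univ t) (mem_univ 0) (inv_nonneg.2 ht0.le)
    (sub_nonneg.2 (inv_le_one_of_one_le₀ ht)) (by ring)
  simp only [smul_eq_mul, inv_mul_cancel₀ ht0.ne', mul_zero, add_zero, hα.zero] at h
  rwa [inv_mul_eq_div, le_div_iff₀ ht0, mul_comm] at h

lemma locallyLipschitz_supConv (hα : IsYoung α) (hf : ∀ x, |f x| ≤ M) (hlam : 0 < lam) :
    LocallyLipschitz (supConv α lam f) := by
  set r : ℝ := max 1 ((2 * M + 1) / (lam * α 1)) with hr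
  have hfar : ∀ t, r < t → 2 * M + 1 < lam * α t := by
    intro t ht
    have h1 : 1 ≤ t := (le_max_left _ _).trans ht.le
    have h2 := (le_max_right 1 ((2 * M + 1) / (lam * α 1))).trans_lt ht
    rw [div_lt_iff₀ (mul_pos hlam (hα.pos one_pos))] at h2
    have := mul_le_mul_of_nonneg_left (hα.mul_le_apply h1) hlam.le
    linarith
  obtain ⟨L, hL⟩ := LocallyLipschitzOn.exists_lipschitzOnWith_of_compact
    (isCompact_Icc (a := (0 : ℝ)) (b := r + 1)) (hα.convex.locallyLipschitz.locallyLipschitzOn)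
  have key : ∀ x x' : X, dist x x' ≤ 1 →
      supConv α lam f x ≤ supConv α lam f x' + lam * L * dist x x' := by
    intro x x' hxx
    refine le_of_forall_pos_le_add fun ε hε => ?_
    obtain ⟨y, hy⟩ := exists_supConv_le_add α lam f x (lt_min hε one_pos)
    have hy1 : min ε 1 ≤ ε := min_le_left _ _
    have hy2 : min ε 1 ≤ 1 := min_le_right _ _
    have hd : dist x y ≤ r := by
      by_contra! hcon
      linarith [hfar _ hcon, le_supConv hα hf hlam.le x, le_of_abs_le (hf y),
        neg_le_of_abs_le (hf x)]
    have hd' : dist x' y ≤ dist x x' + dist x y := by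
      rw [dist_comm x x']; exact dist_triangle _ _ _
    have h1 := le_supConv_of_bdd hα hf hlam.le x' y
    have h2 := hL.dist_le_mul (dist x' y) ⟨dist_nonneg, by linarith⟩ (dist x y)
      ⟨dist_nonneg, by linarith⟩
    rw [Real.dist_eq, Real.dist_eq] at h2
    have h3 : |dist x' y - dist x y| ≤ dist x x' := by
      rw [dist_comm x x']; exact abs_dist_sub_le _ _ _
    have h4 : α (dist x' y) - α (dist x y) ≤ L * dist x x' :=
      (le_abs_self _).trans (h2.trans (mul_le_mul_of_nonneg_left h3 L.2))
    have h5 := mul_le_mul_of_nonneg_left h4 hlam.le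
    linarith
  intro x
  refine ⟨⟨lam, hlam.le⟩ * L, Metric.ball x (1 / 2), Metric.ball_mem_nhds x (by norm_num), ?_⟩
  refine LipschitzOnWith.of_dist_le_mul fun y hy z hz => ?_
  have hyz : dist y z ≤ 1 := by
    have := dist_triangle_right y z x
    have := Metric.mem_ball.1 hy
    have := Metric.mem_ball.1 hz
    linarith
  have h1 := key y z hyz
  have h2 := key z y (by rwa [dist_comm])
  rw [dist_comm z y] at h2
  rw [Real.dist_eq, abs_le]
  change -(lam * L * dist y z) ≤ _ ∧ _ ≤ lam * L * dist y z
  constructor <;> linarith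

lemma abs_QInf_one_le [MeasurableSpace X] (hα : IsYoung α) (hf : ∀ x, |f x| ≤ M) (x : X) :
    |QInf α 1 f x| ≤ M := by
  rw [QInf_one_eq_neg_supConv, abs_neg]
  exact abs_supConv_le hα (fun x => by simpa using hf x) zero_le_one x

lemma QInf_one_le [MeasurableSpace X] (hα : IsYoung α) (hf : ∀ x, |f x| ≤ M) (x : X) :
    QInf α 1 f x ≤ f x := by
  rw [QInf_one_eq_neg_supConv, neg_le]
  exact le_supConv (f := fun y => -f y) hα (fun x => by simpa using hf x) zero_le_one x

/-- The defect `g - Q g` of a multiple of a sup-convolution is controlled by the variation of the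
sup-convolution in its parameter. -/
lemma sub_QInf_supConv_le [MeasurableSpace X] (hα : IsYoung α) (hΔ : DeltaTwo α)
    (hf : ∀ x, |f x| ≤ M) {lam' k w : ℝ} (hlam : 0 ≤ lam) (h : lam < lam') (hk : 0 < k)
    (hw : 0 < w) (hw1 : w < 1) (hkw : k * lam' = w ^ (pAlpha α - 1)) (x : X) :
    k * supConv α lam' f x - QInf α 1 (fun z => k * supConv α lam' f z) x ≤
      k * lam' * ((1 - w) ^ (-(pAlpha α - 1)) - 1) / (lam' - lam) *
        (supConv α lam f x - supConv α lam' f x) := by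
  have hlam' : 0 < lam' := hlam.trans_lt h
  have hq : 0 < pAlpha α - 1 := by linarith [hα.one_lt_pAlpha hΔ]
  have hG : 0 ≤ (1 - w) ^ (-(pAlpha α - 1)) - 1 := by
    have := Real.one_le_rpow_of_pos_of_le_one_of_nonpos (x := 1 - w) (by linarith) (by linarith)
      (neg_nonpos.2 hq.le)
    linarith
  set G := (1 - w) ^ (-(pAlpha α - 1)) - 1 with hGdef
  have hS : 0 ≤ k * lam' * G / (lam' - lam) :=
    div_nonneg (mul_nonneg (mul_pos hk hlam').le hG) (by linarith)
  set S := k * lam' * G / (lam' - lam) with hSdef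
  refine le_of_forall_pos_le_add fun η hη => ?_
  have hc : 0 < k + S := by linarith
  obtain ⟨y, hy⟩ := exists_supConv_le_add α lam' f x (div_pos hη hc)
  set ε := η / (k + S) with hε
  have hεη : k * ε + S * ε = η := by rw [← add_mul, hε, mul_div_cancel₀ _ hc.ne']
  have h1 : (lam' - lam) * α (dist x y) ≤ supConv α lam f x - supConv α lam' f x + ε := by
    linarith [le_supConv_of_bdd hα hf hlam x y]
  have h2 : k * lam' * G * α (dist x y) ≤
      S * (supConv α lam f x - supConv α lam' f x + ε) := by
    have hne : lam' - lam ≠ 0 := by linarith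
    calc k * lam' * G * α (dist x y) = S * ((lam' - lam) * α (dist x y)) := by
          rw [hSdef]; field_simp
      _ ≤ _ := mul_le_mul_of_nonneg_left h1 hS
  have h3 : k * supConv α lam' f x - k * ε - k * lam' * G * α (dist x y) ≤
      QInf α 1 (fun z => k * supConv α lam' f z) x := by
    have : Nonempty X := ⟨x⟩
    refine le_ciInf fun z => ?_
    have h4 := mul_le_mul_of_nonneg_left (le_supConv_of_bdd hα hf hlam'.le z y) hk.le
    have h5 : α (dist z y) ≤ α (dist x y + dist x z) :=
      hα.le_of_le dist_nonneg (by
        rw [add_comm, dist_comm x z]; exact dist_triangle _ _ _)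
    have h6 := h5.trans (hα.apply_add_le hΔ hw hw1 dist_nonneg dist_nonneg)
    have h7 : k * lam' * (w ^ (-(pAlpha α - 1)) * α (dist x z)) = α (dist x z) := by
      rw [hkw, ← mul_assoc, ← Real.rpow_add hw]; simp
    have h8 := mul_le_mul_of_nonneg_left h6 (mul_pos hk hlam').le
    rw [mul_add, h7] at h8
    have h9 := mul_le_mul_of_nonneg_left hy hk.le
    have h10 : k * lam' * ((1 - w) ^ (-(pAlpha α - 1)) * α (dist x y)) =
        k * lam' * G * α (dist x y) + k * lam' * α (dist x y) := by rw [hGdef]; ring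
    rw [h10] at h8
    linarith
  linarith

lemma TauLSI.mono [MeasurableSpace X] {μ : Measure X} (hα : IsYoung α) {A A' : ℝ}
    (h : TauLSI μ α 1 A) (hA : A ≤ A') :
    TauLSI μ α 1 A' := by
  intro g hg hgL
  refine (h g hg hgL).trans (mul_le_mul_of_nonneg_right hA (integral_nonneg fun x => ?_))
  obtain ⟨N, hN⟩ := hg
  exact mul_nonneg (sub_nonneg.2 (QInf_one_le hα hN x)) (Real.exp_pos _).le

end SupConv

section LogLaplace

variable {X : Type*} [MeasurableSpace X] {μ : Measure X} [IsProbabilityMeasure μ] {M : ℝ}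

lemma integrable_of_abs_le {g : X → ℝ} (hg : Measurable g) (hM : ∀ x, |g x| ≤ M) :
    Integrable g μ :=
  Integrable.of_bound hg.aestronglyMeasurable M (Eventually.of_forall hM)

lemma abs_mul_exp_le {Y : Type*} {g h : Y → ℝ} {M N : ℝ} (hM : ∀ x, |g x| ≤ M)
    (hN : ∀ x, |h x| ≤ N) (x : Y) :
    |h x * Real.exp (g x)| ≤ N * Real.exp M := by
  rw [abs_mul, Real.abs_exp]
  exact mul_le_mul (hN x) (Real.exp_le_exp.2 (le_of_abs_le (hM x))) (Real.exp_pos _).le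
    ((abs_nonneg _).trans (hN x))

lemma integrable_mul_exp {g h : X → ℝ} {N : ℝ} (hg : Measurable g) (hM : ∀ x, |g x| ≤ M)
    (hh : Measurable h) (hN : ∀ x, |h x| ≤ N) :
    Integrable (fun x => h x * Real.exp (g x)) μ :=
  integrable_of_abs_le (hh.mul hg.exp) (abs_mul_exp_le hM hN)

lemma integrable_exp_of_abs_le {g : X → ℝ} (hg : Measurable g) (hM : ∀ x, |g x| ≤ M) :
    Integrable (fun x => Real.exp (g x)) μ := by
  simpa using integrable_mul_exp (h := fun _ => 1) (N := 1) hg hM measurable_const (by simp)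

/-- Convexity of the log-Laplace functional. -/
lemma log_integral_exp_add_le {g g' : X → ℝ} (hg : Measurable g) (hM : ∀ x, |g x| ≤ M)
    (hg' : Measurable g') (hM' : ∀ x, |g' x| ≤ M) :
    Real.log (∫ x, Real.exp (g' x) ∂μ) +
        (∫ x, (g x - g' x) * Real.exp (g' x) ∂μ) / ∫ x, Real.exp (g' x) ∂μ ≤
      Real.log (∫ x, Real.exp (g x) ∂μ) := by
  have hi' : Integrable (fun x => Real.exp (g' x)) μ := integrable_exp_of_abs_le hg' hM'
  have hi : Integrable (fun x => Real.exp (g x)) μ := integrable_exp_of_abs_le hg hM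
  have hE' := integral_exp_pos hi'
  have hE := integral_exp_pos hi
  set t := (∫ x, (g x - g' x) * Real.exp (g' x) ∂μ) / ∫ x, Real.exp (g' x) ∂μ with ht
  have hdi : Integrable (fun x => (g x - g' x) * Real.exp (g' x)) μ :=
    integrable_mul_exp (N := M + M) hg' hM' (hg.sub hg') fun x =>
      (abs_sub _ _).trans (add_le_add (hM x) (hM' x))
  have htE : ∫ x, (g x - g' x) * Real.exp (g' x) ∂μ = t * ∫ x, Real.exp (g' x) ∂μ := by
    rw [ht, div_mul_cancel₀ _ hE'.ne']
  rw [Real.le_log_iff_exp_le hE, Real.exp_add, Real.exp_log hE']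
  calc (∫ x, Real.exp (g' x) ∂μ) * Real.exp t
      = ∫ x, Real.exp t * ((1 - t) * Real.exp (g' x) + (g x - g' x) * Real.exp (g' x)) ∂μ := by
        rw [integral_const_mul, integral_add (hi'.const_mul _) hdi, integral_const_mul, htE]
        ring
    _ ≤ ∫ x, Real.exp (g x) ∂μ := by
        refine integral_mono (((hi'.const_mul _).add hdi).const_mul _) hi fun x => ?_
        have h1 : Real.exp (g x) = Real.exp t * Real.exp (g x - g' x - t) * Real.exp (g' x) := by
          rw [← Real.exp_add, ← Real.exp_add]; congr 1; ring
        have h2 := Real.add_one_le_exp (g x - g' x - t)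
        have h3 := mul_le_mul_of_nonneg_right (mul_le_mul_of_nonneg_left h2 (Real.exp_pos t).le)
          (Real.exp_pos (g' x)).le
        dsimp only
        rw [h1]
        linarith

lemma log_integral_exp_mul_le {P : X → ℝ} (hP : Measurable P) (hM : ∀ x, |P x| ≤ M) {k : ℝ}
    (hk : 0 ≤ k) (hkM : k * M ≤ 1) :
    Real.log (∫ x, Real.exp (k * P x) ∂μ) ≤ k * ∫ x, P x ∂μ + (k * M) ^ 2 := by
  have hkP : ∀ x, |k * P x| ≤ k * M := fun x => by
    rw [abs_mul, abs_of_nonneg hk]; exact mul_le_mul_of_nonneg_left (hM x) hk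
  have hi : Integrable (fun x => Real.exp (k * P x)) μ :=
    integrable_exp_of_abs_le (hP.const_mul k) hkP
  have hPi : Integrable P μ := integrable_of_abs_le hP hM
  have h1 := Real.log_le_sub_one_of_pos (integral_exp_pos hi)
  have h2 : ∫ x, Real.exp (k * P x) ∂μ ≤ ∫ x, (k * P x + (1 + (k * M) ^ 2)) ∂μ := by
    refine integral_mono hi ((hPi.const_mul k).add (integrable_const _)) fun x => ?_
    have h3 := (abs_le.1 (Real.abs_exp_sub_one_sub_id_le ((hkP x).trans hkM))).2
    have h4 : (k * P x) ^ 2 ≤ (k * M) ^ 2 := sq_le_sq.2 ((hkP x).trans (le_abs_self _))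
    dsimp only
    linarith
  rw [integral_add (hPi.const_mul k) (integrable_const _), integral_const_mul] at h2
  simp only [integral_const, probReal_univ, smul_eq_mul, one_mul] at h2
  linarith

lemma log_integral_exp_div_sub_le [MetricSpace X] {P P' : X → ℝ} (hP : Measurable P)
    (hM : ∀ x, |P x| ≤ M) (hP' : Measurable P') (hM' : ∀ x, |P' x| ≤ M) {k k' S J : ℝ} (hk : 0 < k)
    (hkk : k < k') (hle : ∀ x, P' x ≤ P x) (hJ : ∀ x, P x - P' x ≤ J)
    (hent : entExp μ (fun x => k' * P' x) ≤
      S * ∫ x, (P x - P' x) * Real.exp (k' * P' x) ∂μ) :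
    Real.log (∫ x, Real.exp (k' * P' x) ∂μ) / k' - Real.log (∫ x, Real.exp (k * P x) ∂μ) / k ≤
      max 0 ((k' - k) / (k * k') * S - 1) * J := by
  have hk' : 0 < k' := hk.trans hkk
  have bound : ∀ c, 0 ≤ c → c ≤ k' → ∀ R : X → ℝ, (∀ x, |R x| ≤ M) → ∀ x, |c * R x| ≤ k' * M := by
    intro c hc hck R hR x
    rw [abs_mul, abs_of_nonneg hc]
    exact mul_le_mul hck (hR x) (abs_nonneg _) hk'.le
  have hb' := bound k' hk'.le le_rfl P' hM'
  have hb := bound k hk.le hkk.le P hM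
  have hmg' : Measurable fun x => k' * P' x := hP'.const_mul k'
  have hi : Integrable (fun x => Real.exp (k' * P' x)) μ := integrable_exp_of_abs_le hmg' hb'
  have hE := integral_exp_pos hi
  have hcvx := log_integral_exp_add_le (μ := μ) (hP.const_mul k) hb hmg' hb'
  have hiU : Integrable (fun x => P' x * Real.exp (k' * P' x)) μ :=
    integrable_mul_exp hmg' hb' hP' hM'
  have hiI : Integrable (fun x => (P x - P' x) * Real.exp (k' * P' x)) μ :=
    integrable_mul_exp (N := M + M) hmg' hb' (hP.sub hP') fun x =>
      (abs_sub _ _).trans (add_le_add (hM x) (hM' x))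
  set E := ∫ x, Real.exp (k' * P' x) ∂μ with hEdef
  set L := Real.log (∫ x, Real.exp (k * P x) ∂μ) with hL
  set U := (∫ x, P' x * Real.exp (k' * P' x) ∂μ) / E with hU
  set I := (∫ x, (P x - P' x) * Real.exp (k' * P' x) ∂μ) / E with hI
  have hUE : ∫ x, P' x * Real.exp (k' * P' x) ∂μ = U * E := by rw [hU, div_mul_cancel₀ _ hE.ne']
  have hIE : ∫ x, (P x - P' x) * Real.exp (k' * P' x) ∂μ = I * E := by
    rw [hI, div_mul_cancel₀ _ hE.ne']
  have hI0 : 0 ≤ I := div_nonneg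
    (integral_nonneg fun x => mul_nonneg (sub_nonneg.2 (hle x)) (Real.exp_pos _).le) hE.le
  have hIJ : I ≤ J := by
    rw [hI, div_le_iff₀ hE, hEdef, ← integral_const_mul]
    exact integral_mono hiI (hi.const_mul J) fun x =>
      mul_le_mul_of_nonneg_right (hJ x) (Real.exp_pos _).le
  have hdiff : (∫ x, (k * P x - k' * P' x) * Real.exp (k' * P' x) ∂μ) / E =
      k * I - (k' - k) * U := by
    have : ∀ x, (k * P x - k' * P' x) * Real.exp (k' * P' x) =
        k * ((P x - P' x) * Real.exp (k' * P' x)) -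
          (k' - k) * (P' x * Real.exp (k' * P' x)) := fun x => by ring
    simp_rw [this]
    rw [integral_sub (hiI.const_mul k) (hiU.const_mul _), integral_const_mul, integral_const_mul,
      hIE, hUE]
    field_simp
  rw [hdiff] at hcvx
  have hent' : k' * U - Real.log E ≤ S * I := by
    have h1 : entExp μ (fun x => k' * P' x) = (k' * U - Real.log E) * E := by
      have : ∀ x, Real.exp (k' * P' x) * Real.log (Real.exp (k' * P' x)) =
          k' * (P' x * Real.exp (k' * P' x)) := fun x => by rw [Real.log_exp]; ring
      simp only [entExp, this]
      rw [integral_const_mul, hUE]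
      ring
    rw [h1, hIE, ← mul_assoc] at hent
    exact le_of_mul_le_mul_right hent hE
  have hc : 0 ≤ (k' - k) / (k * k') := div_nonneg (by linarith) (by positivity)
  calc Real.log E / k' - L / k
      ≤ Real.log E / k' - (Real.log E + (k * I - (k' - k) * U)) / k := by gcongr
    _ = (k' - k) / (k * k') * (k' * U - Real.log E) - I := by field_simp; ring
    _ ≤ (k' - k) / (k * k') * (S * I) - I := by gcongr
    _ = ((k' - k) / (k * k') * S - 1) * I := by ring
    _ ≤ max 0 ((k' - k) / (k * k') * S - 1) * I :=
        mul_le_mul_of_nonneg_right (le_max_right _ _) hI0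
    _ ≤ _ := mul_le_mul_of_nonneg_left hIJ (le_max_left _ _)

end LogLaplace

/-- A function whose increments are locally at most quadratic does not increase. -/
lemma le_of_sub_le_mul_sq {F : ℝ → ℝ} {a b K δ : ℝ} (hab : a < b) (hδ : 0 < δ)
    (h : ∀ x y, a ≤ x → y ≤ b → x < y → y - x ≤ δ → F y - F x ≤ K * (y - x) ^ 2) :
    F b ≤ F a := by
  have hlim : Tendsto (fun n : ℕ => K * (b - a) ^ 2 * ((n : ℝ))⁻¹) atTop (𝓝 0) := by
    simpa using (tendsto_inv_atTop_nhds_zero_nat (𝕜 := ℝ)).const_mul (K * (b - a) ^ 2)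
  obtain ⟨N, hN⟩ := exists_nat_gt ((b - a) / δ)
  refine sub_nonpos.1 (ge_of_tendsto hlim ?_)
  filter_upwards [eventually_ge_atTop (N + 1)] with n hn
  have hn0 : (0 : ℝ) < n := by exact_mod_cast (Nat.succ_pos N).trans_le hn
  have hnN : (N : ℝ) ≤ n := by exact_mod_cast (Nat.le_succ N).trans hn
  set u := (b - a) / n with hu
  have hu0 : 0 < u := div_pos (by linarith) hn0
  have hun : n * u = b - a := by rw [hu]; field_simp
  have huδ : u ≤ δ := by
    rw [hu, div_le_iff₀ hn0, ← div_le_iff₀' hδ]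
    linarith
  have hstep : ∀ i : ℕ, i ≤ n → F (a + i * u) - F a ≤ i * (K * u ^ 2) := by
    intro i
    induction i with
    | zero => simp
    | succ i ih =>
      intro hi
      have h1 := ih (by lia)
      have hi' : ((i + 1 : ℕ) : ℝ) * u ≤ n * u :=
        mul_le_mul_of_nonneg_right (by exact_mod_cast hi) hu0.le
      have h0 : 0 ≤ (i : ℝ) * u := by positivity
      push_cast at hi' ⊢
      have h2 := h (a + i * u) (a + (i + 1) * u) (by linarith) (by linarith) (by linarith)
        (by linarith)
      rw [show a + (i + 1) * u - (a + i * u) = u by ring] at h2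
      linarith
  have h3 := hstep n le_rfl
  rw [hun, add_sub_cancel] at h3
  refine h3.trans_eq ?_
  rw [hu]
  field_simp

lemma one_sub_rpow_neg_sub_one_le {p w : ℝ} (hp : 1 < p) (hw : 0 ≤ w) (hwp : p * w ≤ 1) :
    (1 - w) ^ (-(p - 1)) - 1 ≤ p * w * ((1 - 1 / p) ^ (-(p - 1)) - 1) := by
  have hp0 : 0 < p := by linarith
  have hpw : 0 ≤ p * w := mul_nonneg hp0.le hw
  have h1 : 0 < 1 - 1 / p := by
    rw [sub_pos, div_lt_one hp0]; exact hp
  have hw1 : w ≤ 1 / p := by rw [le_div_iff₀ hp0]; linarith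
  have hlog := strictConcaveOn_log_Ioi.concaveOn.2 (mem_Ioi.2 one_pos) (mem_Ioi.2 h1)
    (sub_nonneg.2 hwp) hpw (by ring)
  have hcomb : (1 - p * w) * 1 + p * w * (1 - 1 / p) = 1 - w := by field_simp; ring
  simp only [smul_eq_mul, Real.log_one, mul_zero, zero_add, hcomb] at hlog
  have hexp := convexOn_exp.2 (mem_univ 0) (mem_univ (Real.log (1 - 1 / p) * -(p - 1)))
    (sub_nonneg.2 hwp) hpw (by ring)
  simp only [smul_eq_mul, mul_zero, zero_add, Real.exp_zero, mul_one] at hexp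
  rw [Real.rpow_def_of_pos (by linarith : 0 < 1 - w), Real.rpow_def_of_pos h1]
  have hle : Real.log (1 - w) * -(p - 1) ≤ p * w * (Real.log (1 - 1 / p) * -(p - 1)) := by
    have := mul_le_mul_of_nonneg_right hlog (show 0 ≤ p - 1 by linarith)
    linarith
  have := Real.exp_le_exp.2 hle
  linarith

lemma one_add_rpow_le {q v : ℝ} (hv : -1 < v) (hq : 0 ≤ q) (h : |q * v| ≤ 1) :
    (1 + v) ^ q ≤ 1 + q * v + (q * v) ^ 2 := by
  have h1 : (1 + v) ^ q ≤ Real.exp (q * v) := by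
    rw [Real.rpow_def_of_pos (by linarith), mul_comm]
    have := Real.log_le_sub_one_of_pos (show 0 < 1 + v by linarith)
    exact Real.exp_le_exp.2 (mul_le_mul_of_nonneg_left (by linarith) hq)
  have h2 := (abs_le.1 (Real.abs_exp_sub_one_sub_id_le h)).2
  linarith

/-- Along the curve `k = s ^ q`, `lam = (1 - a s)⁻¹ ^ q`, the increments of `lam` and of `log k`
balance up to a quadratic error. -/
lemma balance_le_mul_sq {q a s s' s₀ m₁ : ℝ} (hq : 0 < q) (ha : 0 < a) (hs₀ : 0 < s₀)
    (hs : s₀ ≤ s) (hss : s < s') (hs1 : a * s' < 1) (hm₁ : (1 - a * s')⁻¹ ≤ m₁)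
    (hw : s' * (1 - a * s')⁻¹ ≤ 1)
    (hδ₁ : q * (s' - s) ≤ s₀) (hδ₂ : q * a * m₁ * (s' - s) ≤ 1) :
    (s' ^ q / s ^ q - 1) * ((1 - a * s')⁻¹ ^ q * (a * (s' * (1 - a * s')⁻¹))) -
        ((1 - a * s')⁻¹ ^ q - (1 - a * s)⁻¹ ^ q) ≤
      m₁ ^ q * ((q / s₀) ^ 2 * a + (q * a * m₁) ^ 2 + q * a * m₁ ^ 2 / s₀) * (s' - s) ^ 2 := by
  have hs0 : 0 < s := hs₀.trans_le hs
  have hs'0 : 0 < s' := hs0.trans hss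
  have hd' : 0 < 1 - a * s' := by linarith
  have hdd : 1 - a * s' < 1 - a * s := by
    have := mul_lt_mul_of_pos_left hss ha
    linarith
  have hd : 0 < 1 - a * s := hd'.trans hdd
  obtain ⟨u, hu⟩ : ∃ u, u = s' - s := ⟨_, rfl⟩
  have hu0 : 0 < u := by linarith
  obtain ⟨m, hm⟩ : ∃ m, m = (1 - a * s)⁻¹ := ⟨_, rfl⟩
  obtain ⟨m', hm'⟩ : ∃ m', m' = (1 - a * s')⁻¹ := ⟨_, rfl⟩
  have hm0 : 0 < m := hm ▸ inv_pos.2 hd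
  have hm'0 : 0 < m' := hm' ▸ inv_pos.2 hd'
  have hmm : m ≤ m' := by rw [hm, hm']; exact inv_anti₀ hd' hdd.le
  rw [← hm'] at hm₁ hw ⊢
  rw [← hm, ← hu]
  rw [← hu] at hδ₁ hδ₂
  have hm₁0 : 0 < m₁ := hm'0.trans_le hm₁
  -- growth of `k`
  have hk : s' ^ q / s ^ q ≤ 1 + q * (u / s) + (q * (u / s)) ^ 2 := by
    rw [← Real.div_rpow (by linarith) hs0.le, show s' / s = 1 + u / s by rw [hu]; field_simp; ring]
    have hus : 0 < u / s := div_pos hu0 hs0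
    refine one_add_rpow_le (by linarith) hq.le ?_
    rw [abs_of_nonneg (by positivity), ← mul_div_assoc, div_le_one hs0]
    linarith
  -- growth of `lam`
  have hratio : m / m' = 1 + -(a * u * m) := by
    rw [hm, hm', hu]; field_simp; ring
  have hl : m ^ q / m' ^ q ≤ 1 + q * -(a * u * m) + (q * -(a * u * m)) ^ 2 := by
    rw [← Real.div_rpow hm0.le hm'0.le, hratio]
    have hpos : 0 < m / m' := div_pos hm0 hm'0
    refine one_add_rpow_le (by linarith) hq.le ?_
    rw [mul_neg, abs_neg, abs_of_nonneg (by positivity)]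
    refine le_trans ?_ hδ₂
    have : q * a * u * m ≤ q * a * u * m₁ :=
      mul_le_mul_of_nonneg_left (hmm.trans hm₁) (by positivity)
    linarith
  have hw' : s' * m' - s * m = u * m * m' := by
    have h1 : m * (1 - a * s) = 1 := by rw [hm, inv_mul_cancel₀ hd.ne']
    have h2 : m' * (1 - a * s') = 1 := by rw [hm', inv_mul_cancel₀ hd'.ne']
    rw [hu]
    linear_combination (-(s' * m')) * h1 + (s * m) * h2
  have hlam' : 0 < m' ^ q := Real.rpow_pos_of_pos hm'0 q
  have hX : (s' ^ q / s ^ q - 1) * (a * (s' * m')) ≤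
      (q * (u / s) + (q * (u / s)) ^ 2) * (a * (s' * m')) :=
    mul_le_mul_of_nonneg_right (by linarith) (by positivity)
  have hlin : q * (u / s) * (a * (s' * m')) = q * a * u * m + q * a * m * m' / s * u ^ 2 := by
    have : s' * m' = s * m + u * m * m' := by linarith
    rw [this]; field_simp
  have hs_inv : q / s ≤ q / s₀ := div_le_div_of_nonneg_left hq.le hs₀ hs
  have e1 : (q * (u / s)) ^ 2 * (a * (s' * m')) ≤ (q / s₀) ^ 2 * a * u ^ 2 := by
    have h1 : (q / s) ^ 2 ≤ (q / s₀) ^ 2 := pow_le_pow_left₀ (by positivity) hs_inv 2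
    have h2 : a * (s' * m') ≤ a := by simpa using mul_le_mul_of_nonneg_left hw ha.le
    calc (q * (u / s)) ^ 2 * (a * (s' * m')) = (q / s) ^ 2 * (a * (s' * m')) * u ^ 2 := by ring
      _ ≤ (q / s₀) ^ 2 * a * u ^ 2 := by gcongr
  have e2 : (q * -(a * u * m)) ^ 2 ≤ (q * a * m₁) ^ 2 * u ^ 2 := by
    calc (q * -(a * u * m)) ^ 2 = (q * a * m) ^ 2 * u ^ 2 := by ring
      _ ≤ _ := by gcongr; exact hmm.trans hm₁
  have e3 : q * a * m * m' / s * u ^ 2 ≤ q * a * m₁ ^ 2 / s₀ * u ^ 2 := by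
    rw [show q * a * m * m' / s = q * a * (m * m') / s by ring, sq m₁]
    gcongr
    exact hmm.trans hm₁
  calc (s' ^ q / s ^ q - 1) * (m' ^ q * (a * (s' * m'))) - (m' ^ q - m ^ q)
      = m' ^ q * ((s' ^ q / s ^ q - 1) * (a * (s' * m')) - 1 + m ^ q / m' ^ q) := by
        field_simp; ring
    _ ≤ m' ^ q * (((q / s₀) ^ 2 * a + (q * a * m₁) ^ 2 + q * a * m₁ ^ 2 / s₀) * u ^ 2) := by
        refine mul_le_mul_of_nonneg_left ?_ hlam'.le
        linarith
    _ ≤ m₁ ^ q * (((q / s₀) ^ 2 * a + (q * a * m₁) ^ 2 + q * a * m₁ ^ 2 / s₀) * u ^ 2) := by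
        gcongr
    _ = _ := by ring

section Herbst

variable {X : Type*} [MetricSpace X] [MeasurableSpace X] [BorelSpace X] {α : ℝ → ℝ} {f : X → ℝ}
  {M : ℝ} {μ : Measure X}

lemma measurable_supConv (hα : IsYoung α) (hf : ∀ x, |f x| ≤ M) {lam : ℝ} (hlam : 0 < lam) :
    Measurable (supConv α lam f) :=
  (locallyLipschitz_supConv hα hf hlam).continuous.measurable

lemma measurable_QInf_one (hα : IsYoung α) (hf : ∀ x, |f x| ≤ M) : Measurable (QInf α 1 f) := by
  have h : QInf α 1 f = fun x => -supConv α 1 (fun y => -f y) x :=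
    funext (QInf_one_eq_neg_supConv α f)
  rw [h]
  exact (measurable_supConv hα (M := M) (fun x => by simpa using hf x) one_pos).neg

variable [IsProbabilityMeasure μ]

lemma TauLSI.entExp_supConv_le (hα : IsYoung α) (hΔ : DeltaTwo α) {A : ℝ} (hA : 0 ≤ A)
    (hLSI : TauLSI μ α 1 A) (hf : ∀ x, |f x| ≤ M) {lam lam' k w : ℝ} (hlam : 0 < lam)
    (h : lam < lam') (hk : 0 < k) (hw : 0 < w) (hw1 : w < 1)
    (hkw : k * lam' = w ^ (pAlpha α - 1)) :
    entExp μ (fun x => k * supConv α lam' f x) ≤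
      A * (k * lam' * ((1 - w) ^ (-(pAlpha α - 1)) - 1) / (lam' - lam)) *
        ∫ x, (supConv α lam f x - supConv α lam' f x) *
          Real.exp (k * supConv α lam' f x) ∂μ := by
  have hlam' := hlam.trans h
  have hb : ∀ x, |k * supConv α lam' f x| ≤ k * M := fun x => by
    rw [abs_mul, abs_of_pos hk]
    exact mul_le_mul_of_nonneg_left (abs_supConv_le hα hf hlam'.le x) hk.le
  have hm : Measurable fun x => k * supConv α lam' f x :=
    (measurable_supConv hα hf hlam').const_mul k
  have hL : LocallyLipschitz fun x => k * supConv α lam' f x :=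
    (lipschitzWith_smul k).locallyLipschitz.comp (locallyLipschitz_supConv hα hf hlam')
  refine (hLSI _ ⟨_, hb⟩ hL).trans ?_
  rw [mul_assoc]
  refine mul_le_mul_of_nonneg_left ?_ hA
  rw [← integral_const_mul]
  refine integral_mono ?_ ?_ fun x => ?_
  · exact integrable_mul_exp (N := k * M + k * M) hm hb (hm.sub (measurable_QInf_one hα hb))
      fun x => (abs_sub _ _).trans (add_le_add (hb x) (abs_QInf_one_le hα hb x))
  · exact (integrable_mul_exp (N := M + M) hm hb
      ((measurable_supConv hα hf hlam).sub (measurable_supConv hα hf hlam'))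
      fun x => (abs_sub _ _).trans (add_le_add (abs_supConv_le hα hf hlam.le x)
        (abs_supConv_le hα hf hlam'.le x))).const_mul _
  · dsimp only
    rw [← mul_assoc]
    exact mul_le_mul_of_nonneg_right
      (sub_QInf_supConv_le hα hΔ hf hlam.le h hk hw hw1 hkw x) (Real.exp_pos _).le

/-- Monotonicity of the normalized log-Laplace transform along sup-convolutions. -/
lemma TauLSI.log_integral_exp_supConv_div_le (hα : IsYoung α) (hΔ : DeltaTwo α) {A a : ℝ}
    (hA : 0 < A) (hLSI : TauLSI μ α 1 A) (hf : ∀ x, |f x| ≤ M)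
    (ha : a = A * (pAlpha α * ((1 - 1 / pAlpha α) ^ (-(pAlpha α - 1)) - 1)))
    {s₀ s₁ : ℝ} (hs₀ : 0 < s₀) (hs₀₁ : s₀ < s₁) (hs₁ : s₁ * (pAlpha α + a) = 1) :
    Real.log (∫ x, Real.exp (s₁ ^ (pAlpha α - 1) *
        supConv α ((1 - a * s₁)⁻¹ ^ (pAlpha α - 1)) f x) ∂μ) / s₁ ^ (pAlpha α - 1) ≤
      Real.log (∫ x, Real.exp (s₀ ^ (pAlpha α - 1) *
        supConv α ((1 - a * s₀)⁻¹ ^ (pAlpha α - 1)) f x) ∂μ) / s₀ ^ (pAlpha α - 1) := by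
  have hM : 0 ≤ M := by
    obtain ⟨x⟩ : Nonempty X := μ.nonempty_of_neZero
    exact (abs_nonneg _).trans (hf x)
  have hp : 1 < pAlpha α := hα.one_lt_pAlpha hΔ
  set p := pAlpha α with hpdef
  have hp0 : 0 < p := by linarith
  have hq : 0 < p - 1 := by linarith
  have ha0 : 0 < a := by
    rw [ha]
    have h1 : 1 - 1 / p < 1 := by have : 0 < 1 / p := by positivity
                                  linarith
    have h0 : 0 < 1 - 1 / p := by rw [sub_pos, div_lt_one hp0]; exact hp
    have := Real.one_lt_rpow_of_pos_of_lt_one_of_neg h0 h1 (neg_neg_of_pos hq)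
    exact mul_pos hA (mul_pos hp0 (by linarith))
  set q := p - 1 with hqdef
  set m₁ := (1 - a * s₁)⁻¹ with hm₁
  have has₁ : a * s₁ < 1 := by nlinarith
  have hm₁0 : 0 < m₁ := inv_pos.2 (by linarith)
  set c := m₁ ^ q * ((q / s₀) ^ 2 * a + (q * a * m₁) ^ 2 + q * a * m₁ ^ 2 / s₀) with hc
  refine le_of_sub_le_mul_sq (F := fun s => Real.log (∫ x, Real.exp (s ^ q *
    supConv α ((1 - a * s)⁻¹ ^ q) f x) ∂μ) / s ^ q) (K := 2 * M * c)
    (δ := min (s₀ / q) (1 / (q * a * m₁))) hs₀₁ (lt_min (by positivity) (by positivity)) ?_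
  intro s s' hs hs' hss hδ
  have hδ₁ : q * (s' - s) ≤ s₀ := by
    have := hδ.trans (min_le_left _ _)
    rwa [le_div_iff₀ hq, mul_comm] at this
  have hδ₂ : q * a * m₁ * (s' - s) ≤ 1 := by
    have := hδ.trans (min_le_right _ _)
    rwa [le_div_iff₀ (by positivity), mul_comm] at this
  have hs0 : 0 < s := hs₀.trans_le hs
  have hs'0 : 0 < s' := hs0.trans hss
  have has' : a * s' ≤ a * s₁ := mul_le_mul_of_nonneg_left hs' ha0.le
  have has : a * s < a * s' := mul_lt_mul_of_pos_left hss ha0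
  have has0 : 0 < a * s := mul_pos ha0 hs0
  have hd' : 0 < 1 - a * s' := by linarith
  have hd : 0 < 1 - a * s := by linarith
  have hm' : (1 - a * s')⁻¹ ≤ m₁ := inv_anti₀ (by linarith) (by linarith)
  have hm'0 : 0 < (1 - a * s')⁻¹ := inv_pos.2 hd'
  have hmm : (1 - a * s)⁻¹ < (1 - a * s')⁻¹ := inv_strictAnti₀ hd' (by linarith)
  have hm1 : 1 ≤ (1 - a * s)⁻¹ := (one_le_inv₀ hd).2 (by linarith)
  have hpw : p * (s' * (1 - a * s')⁻¹) ≤ 1 := by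
    rw [← mul_assoc, ← div_eq_mul_inv, div_le_one hd']
    have : s' * (p + a) ≤ s₁ * (p + a) := mul_le_mul_of_nonneg_right hs' (by linarith)
    linarith
  set w := s' * (1 - a * s')⁻¹ with hw
  have hw0 : 0 < w := mul_pos hs'0 hm'0
  have hw1 : w < 1 := by nlinarith
  have hbal := balance_le_mul_sq hq ha0 hs₀ hs hss (by linarith) hm' hw1.le hδ₁ hδ₂
  rw [← hw, ← hc] at hbal
  have hlam1 : 1 ≤ (1 - a * s)⁻¹ ^ q := Real.one_le_rpow hm1 hq.le
  have hlamlt : (1 - a * s)⁻¹ ^ q < (1 - a * s')⁻¹ ^ q :=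
    Real.rpow_lt_rpow (by linarith) hmm hq
  have hkw : s' ^ q * (1 - a * s')⁻¹ ^ q = w ^ q := (Real.mul_rpow hs'0.le hm'0.le).symm
  have hklt : s ^ q < s' ^ q := Real.rpow_lt_rpow hs0.le hss hq
  have hk0 : 0 < s ^ q := Real.rpow_pos_of_pos hs0 q
  have hc0 : 0 ≤ c := by positivity
  have hGw : A * ((1 - w) ^ (-q) - 1) ≤ a * w := by
    have := mul_le_mul_of_nonneg_left (one_sub_rpow_neg_sub_one_le hp hw0.le hpw) hA.le
    rw [ha]
    linarith
  set lam := (1 - a * s)⁻¹ ^ q with hlamdef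
  set lam' := (1 - a * s')⁻¹ ^ q with hlam'def
  set k := s ^ q with hkdef
  set k' := s' ^ q with hk'def
  have hlam0 : 0 < lam := by linarith
  have hlam'0 : 0 < lam' := by linarith
  have hk'0 : 0 < k' := by linarith
  have hent := hLSI.entExp_supConv_le hα hΔ hA.le hf hlam0 hlamlt hk'0 hw0 hw1 hkw
  have hJ : ∀ x, supConv α lam f x - supConv α lam' f x ≤ (lam' - lam) * (2 * M) := by
    intro x
    refine (supConv_sub_le hα hf hlam0 hlamlt.le x).trans
      (mul_le_mul_of_nonneg_left (div_le_self (by linarith) hlam1) (by linarith))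
  refine (log_integral_exp_div_sub_le (measurable_supConv hα hf hlam0)
    (abs_supConv_le hα hf hlam0.le) (measurable_supConv hα hf hlam'0)
    (abs_supConv_le hα hf hlam'0.le) hk0 hklt (supConv_anti hα hf hlam0.le hlamlt.le) hJ
    hent).trans ?_
  have hdlam : 0 < lam' - lam := by linarith
  rw [max_mul_of_nonneg _ _ (by positivity), zero_mul]
  refine max_le (by positivity) ?_
  rw [← hpdef, ← hqdef]
  calc ((k' - k) / (k * k') * (A * (k' * lam' * ((1 - w) ^ (-q) - 1) / (lam' - lam))) - 1) *
        ((lam' - lam) * (2 * M))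
      = 2 * M * ((k' / k - 1) * (lam' * (A * ((1 - w) ^ (-q) - 1))) - (lam' - lam)) := by
        field_simp
    _ ≤ 2 * M * ((k' / k - 1) * (lam' * (a * w)) - (lam' - lam)) := by
        have : 0 ≤ k' / k - 1 := by rw [sub_nonneg, one_le_div hk0]; exact hklt.le
        gcongr
    _ ≤ 2 * M * (c * (s' - s) ^ 2) := mul_le_mul_of_nonneg_left hbal (by linarith)
    _ = _ := by ring

/-- The dual form of the transport-entropy inequality. -/
lemma TauLSI.log_integral_exp_le (hα : IsYoung α) (hΔ : DeltaTwo α) {A a s : ℝ}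
    (hA : 0 < A) (hLSI : TauLSI μ α 1 A) (hfm : Measurable f) (hf : ∀ x, |f x| ≤ M)
    (ha : a = A * (pAlpha α * ((1 - 1 / pAlpha α) ^ (-(pAlpha α - 1)) - 1)))
    (hs : 0 < s) (hs₁ : s * (pAlpha α + a) = 1) (has : 0 ≤ a) :
    Real.log (∫ x, Real.exp (s ^ (pAlpha α - 1) * f x) ∂μ) ≤
      s ^ (pAlpha α - 1) * ∫ x, supConv α 1 f x ∂μ := by
  have hp : 1 < pAlpha α := hα.one_lt_pAlpha hΔ
  set p := pAlpha α with hpdef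
  set q := p - 1 with hqdef
  have hq : 0 < q := by linarith
  have hk : 0 < s ^ q := Real.rpow_pos_of_pos hs q
  have has₁ : a * s < 1 := by nlinarith
  have hm : ∀ t, 0 ≤ t → t ≤ s → 1 ≤ (1 - a * t)⁻¹ ^ q := by
    intro t ht hts
    have h1 : a * t ≤ a * s := mul_le_mul_of_nonneg_left hts has
    have h2 : 0 ≤ a * t := mul_nonneg has ht
    exact Real.one_le_rpow ((one_le_inv₀ (by linarith)).2 (by linarith)) hq.le
  have hbnd : ∀ lam, 0 ≤ lam → ∀ g : X → ℝ, (∀ x, |g x| ≤ M) → ∀ x, |lam * g x| ≤ lam * M :=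
    fun lam hlam g hg x => by
      rw [abs_mul, abs_of_nonneg hlam]; exact mul_le_mul_of_nonneg_left (hg x) hlam
  have hlim : Tendsto (fun t : ℝ => (∫ x, supConv α 1 f x ∂μ) + t ^ q * M ^ 2) (𝓝[>] 0)
      (𝓝 (∫ x, supConv α 1 f x ∂μ)) := by
    have h1 : Tendsto (fun t : ℝ => t ^ q) (𝓝[>] 0) (𝓝 0) := by
      have := (Real.continuousAt_rpow_const 0 q (Or.inr hq.le)).tendsto
      rw [Real.zero_rpow hq.ne'] at this
      exact this.mono_left nhdsWithin_le_nhds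
    simpa using (h1.mul_const (M ^ 2)).const_add (∫ x, supConv α 1 f x ∂μ)
  have hsmall : ∀ᶠ t : ℝ in 𝓝[>] 0, t ^ q * M ≤ 1 := by
    have h1 : Tendsto (fun t : ℝ => t ^ q * M) (𝓝[>] 0) (𝓝 0) := by
      have := ((Real.continuousAt_rpow_const 0 q (Or.inr hq.le)).mul_const M).tendsto
      rw [Real.zero_rpow hq.ne', zero_mul] at this
      exact this.mono_left nhdsWithin_le_nhds
    exact h1.eventually_le_const one_pos
  rw [← div_le_iff₀' hk]
  refine ge_of_tendsto hlim ?_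
  filter_upwards [hsmall, Ioo_mem_nhdsGT hs] with t ht htm
  have hkt : 0 < t ^ q := Real.rpow_pos_of_pos htm.1 q
  have hl1 := hm s hs.le le_rfl
  have hlt := hm t htm.1.le htm.2.le
  have hl1' : (0 : ℝ) < (1 - a * s)⁻¹ ^ q := one_pos.trans_le hl1
  have hlt' : (0 : ℝ) < (1 - a * t)⁻¹ ^ q := one_pos.trans_le hlt
  have hmono := hLSI.log_integral_exp_supConv_div_le hα hΔ hA hf ha htm.1 htm.2 hs₁
  calc Real.log (∫ x, Real.exp (s ^ q * f x) ∂μ) / s ^ q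
      ≤ Real.log (∫ x, Real.exp (s ^ q * supConv α ((1 - a * s)⁻¹ ^ q) f x) ∂μ) / s ^ q := by
        have hi : Integrable (fun x => Real.exp (s ^ q * f x)) μ :=
          integrable_exp_of_abs_le (hfm.const_mul _) (hbnd _ hk.le f hf)
        refine div_le_div_of_nonneg_right (Real.log_le_log (integral_exp_pos hi)
          (integral_mono hi (integrable_exp_of_abs_le
            ((measurable_supConv hα hf hl1').const_mul _)
            (hbnd _ hk.le _ (abs_supConv_le hα hf hl1'.le))) fun x => ?_)) hk.le
        exact Real.exp_le_exp.2 (mul_le_mul_of_nonneg_left (le_supConv hα hf hl1'.le x) hk.le)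
    _ ≤ _ := hmono
    _ ≤ (t ^ q * ∫ x, supConv α ((1 - a * t)⁻¹ ^ q) f x ∂μ + (t ^ q * M) ^ 2) / t ^ q :=
        div_le_div_of_nonneg_right (log_integral_exp_mul_le (measurable_supConv hα hf hlt')
          (abs_supConv_le hα hf hlt'.le) hkt.le ht) hkt.le
    _ = ∫ x, supConv α ((1 - a * t)⁻¹ ^ q) f x ∂μ + t ^ q * M ^ 2 := by field_simp
    _ ≤ _ := by
        gcongr
        · exact integrable_of_abs_le (measurable_supConv hα hf hlt')
            (abs_supConv_le hα hf hlt'.le)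
        · exact integrable_of_abs_le (measurable_supConv hα hf one_pos)
            (abs_supConv_le hα hf zero_le_one)
        · exact fun x => supConv_anti hα hf zero_le_one hlt x

end Herbst

/-- Kantorovich duality on a finite set: a bound on the dual problem yields a coupling. -/
lemma exists_coupling_of_dual_le {ι : Type*} [Fintype ι] [DecidableEq ι] {a b : ι → ℝ}
    (ha : a ∈ stdSimplex ℝ ι) (hb : b ∈ stdSimplex ℝ ι) (c : ι → ι → ℝ) {R : ℝ}
    (h : ∀ φ ψ : ι → ℝ, (∀ i j, φ i - ψ j ≤ c i j) → ∑ i, a i * φ i ≤ ∑ j, b j * ψ j + R) :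
    ∃ w : ι × ι → ℝ, (∀ z, 0 ≤ w z) ∧ (∀ i, ∑ j, w (i, j) = a i) ∧
      (∀ j, ∑ i, w (i, j) = b j) ∧ ∑ z, w z * c z.1 z.2 ≤ R := by
  let Φ : (ι × ι → ℝ) →ₗ[ℝ] (ι → ℝ) × (ι → ℝ) × ℝ :=
    { toFun := fun w => (fun i => ∑ j, w (i, j), fun j => ∑ i, w (i, j), ∑ z, w z * c z.1 z.2)
      map_add' := fun x y => by
        ext <;> simp [Finset.sum_add_distrib, add_mul]
      map_smul' := fun r x => by
        ext <;> simp [Finset.mul_sum, mul_assoc] }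
  by_contra! hcon
  have hdisj : Disjoint (Φ '' stdSimplex ℝ (ι × ι)) ({a} ×ˢ ({b} ×ˢ Iic R)) := by
    rw [Set.disjoint_left]
    rintro _ ⟨w, hw, rfl⟩ ⟨h1, h2, h3⟩
    exact (hcon w hw.1 (congrFun h1) (congrFun h2)).not_ge h3
  obtain ⟨L, u, v, hS, huv, hT⟩ := geometric_hahn_banach_compact_closed
    ((convex_stdSimplex ℝ (ι × ι)).linear_image Φ)
    ((isCompact_stdSimplex ℝ (ι × ι)).image Φ.continuous_of_finiteDimensional)
    ((convex_singleton a).prod ((convex_singleton b).prod (convex_Iic R)))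
    (isClosed_singleton.prod (isClosed_singleton.prod isClosed_Iic)) hdisj
  set f : ι → ℝ := fun i => L (Pi.single i 1, 0, 0)
  set g : ι → ℝ := fun i => L (0, Pi.single i 1, 0)
  set t : ℝ := L (0, 0, 1)
  have hL : ∀ x y r, L (x, y, r) = ∑ i, x i * f i + ∑ j, y j * g j + r * t := by
    intro x y r
    have e1 : (x, y, r) = ∑ i, x i • ((Pi.single i 1, 0, 0) : (ι → ℝ) × (ι → ℝ) × ℝ) +
        ∑ j, y j • ((0, Pi.single j 1, 0) : (ι → ℝ) × (ι → ℝ) × ℝ) +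
        r • ((0, 0, 1) : (ι → ℝ) × (ι → ℝ) × ℝ) := by
      ext <;> simp [Prod.fst_sum, Prod.snd_sum, Finset.sum_apply, Pi.single_apply]
    rw [e1]
    simp only [map_add, map_sum, map_smul, smul_eq_mul, f, g, t]
  have hfg : ∀ i j, f i + g j + c i j * t < u := by
    intro i j
    have := hS _ ⟨Pi.single (i, j) 1, single_mem_stdSimplex ℝ (i, j), rfl⟩
    have e : Φ (Pi.single (i, j) 1) = (Pi.single i 1, Pi.single j 1, c i j) := by
      ext <;> simp [Φ, Pi.single_apply, Fintype.sum_prod_type, Prod.ext_iff, ite_and, eq_comm]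
    rw [e, hL] at this
    simpa [Pi.single_apply] using this
  have hv : ∀ n : ℝ, 0 ≤ n → v < ∑ i, a i * f i + ∑ j, b j * g j + (R - n) * t := by
    intro n hn
    rw [← hL]
    exact hT _ ⟨rfl, rfl, by simpa using hn⟩
  have ht : t ≤ 0 := by
    by_contra! ht
    have h0 := hv 0 le_rfl
    have := hv ((∑ i, a i * f i + ∑ j, b j * g j + R * t - v) / t)
      (div_nonneg (by linarith) ht.le)
    rw [sub_mul, div_mul_cancel₀ _ ht.ne'] at this
    linarith
  have hv0 := hv 0 le_rfl
  rcases ht.eq_or_lt with ht | ht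
  · have key : ∑ i, a i * f i ≤ ∑ i, a i * (u - ∑ j, b j * g j) := by
      refine Finset.sum_le_sum fun i _ => mul_le_mul_of_nonneg_left ?_ (ha.1 i)
      have : ∑ j, b j * g j ≤ ∑ j, b j * (u - f i) :=
        Finset.sum_le_sum fun j _ => mul_le_mul_of_nonneg_left
          (by have := hfg i j; rw [ht] at this; linarith) (hb.1 j)
      rw [← Finset.sum_mul, hb.2] at this
      linarith
    rw [← Finset.sum_mul, ha.2, one_mul] at key
    rw [ht] at hv0
    linarith
  · have ht' : 0 < -t := by linarith
    have key := h (fun i => f i / -t) (fun j => (u - g j) / -t) fun i j => by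
      rw [← sub_div, div_le_iff₀ ht']
      linarith [hfg i j]
    simp only [mul_div_assoc', ← Finset.sum_div] at key
    rw [div_add' _ _ _ ht'.ne', div_le_div_iff_of_pos_right ht'] at key
    simp only [mul_sub, Finset.sum_sub_distrib, ← Finset.sum_mul, hb.2] at key
    linarith

section Gluing

variable {X : Type*} [MeasurableSpace X] {ι : Type*} [Fintype ι] [MeasurableSpace ι]
  [DiscreteMeasurableSpace ι] {T : X → ι} {ν μ : Measure X} [IsProbabilityMeasure ν]
  [IsProbabilityMeasure μ]

/-- The coupling which is a product measure on each cell of a finite partition. -/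
noncomputable def cellCoupling (T : X → ι) (ν μ : Measure X) (w : ι × ι → ℝ) :
    Measure (X × X) :=
  ∑ z, ENNReal.ofReal (w z) •
    (ProbabilityTheory.cond ν (T ⁻¹' {z.1})).prod (ProbabilityTheory.cond μ (T ⁻¹' {z.2}))

lemma sum_measureReal_mul_cond (hT : Measurable T) (s : Set X) :
    ∑ i, ENNReal.ofReal (ν.real (T ⁻¹' {i})) * ProbabilityTheory.cond ν (T ⁻¹' {i}) s = ν s := by
  have h : ∀ i, ENNReal.ofReal (ν.real (T ⁻¹' {i})) * ProbabilityTheory.cond ν (T ⁻¹' {i}) s =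
      ν (s ∩ T ⁻¹' {i}) := by
    intro i
    rw [ofReal_measureReal, mul_comm,
      ProbabilityTheory.cond_mul_eq_inter (hT (measurableSet_singleton i)), inter_comm]
  simp_rw [h]
  have hU : ∀ i, s ∩ T ⁻¹' {i} = T ⁻¹' {i} ∩ s := fun i => inter_comm _ _
  have := sum_measure_preimage_singleton (μ := ν.restrict s) (f := T) Finset.univ
    fun i _ => hT (measurableSet_singleton i)
  simp only [Finset.coe_univ, preimage_univ, Measure.restrict_apply_univ] at this
  rw [← this]
  refine Finset.sum_congr rfl fun i _ => ?_
  rw [hU, Measure.restrict_apply (hT (measurableSet_singleton i))]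

lemma ofReal_mul_cond_univ {w : ℝ} (hw : 0 ≤ w) {s : Set X} (hr : w ≤ μ.real s)
    (c : ℝ≥0∞) :
    ENNReal.ofReal w * (c * ProbabilityTheory.cond μ s univ) = ENNReal.ofReal w * c := by
  by_cases h : μ s = 0
  · have : w = 0 := le_antisymm (hr.trans (by simp [measureReal_def, h])) hw
    simp [this]
  · have := ProbabilityTheory.cond_isProbabilityMeasure h
    simp

variable {w : ι × ι → ℝ}

lemma map_fst_cellCoupling (hT : Measurable T) (hw : ∀ z, 0 ≤ w z)
    (h₁ : ∀ i, ∑ j, w (i, j) = ν.real (T ⁻¹' {i}))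
    (h₂ : ∀ j, ∑ i, w (i, j) = μ.real (T ⁻¹' {j})) :
    (cellCoupling T ν μ w).map Prod.fst = ν := by
  ext s hs
  rw [Measure.map_apply measurable_fst hs, cellCoupling, ← sum_measureReal_mul_cond hT s,
    Measure.finsetSum_apply, Fintype.sum_prod_type]
  refine Finset.sum_congr rfl fun i _ => ?_
  rw [← h₁, ENNReal.ofReal_sum_of_nonneg fun j _ => hw _, Finset.sum_mul]
  refine Finset.sum_congr rfl fun j _ => ?_
  rw [Measure.smul_apply, ← prod_univ, Measure.prod_prod, smul_eq_mul,
    ofReal_mul_cond_univ (hw _)]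
  rw [← h₂]
  exact Finset.single_le_sum (f := fun i => w (i, j)) (fun i _ => hw _) (Finset.mem_univ i)

lemma map_snd_cellCoupling (hT : Measurable T) (hw : ∀ z, 0 ≤ w z)
    (h₁ : ∀ i, ∑ j, w (i, j) = ν.real (T ⁻¹' {i}))
    (h₂ : ∀ j, ∑ i, w (i, j) = μ.real (T ⁻¹' {j})) :
    (cellCoupling T ν μ w).map Prod.snd = μ := by
  ext s hs
  rw [Measure.map_apply measurable_snd hs, cellCoupling, ← sum_measureReal_mul_cond hT s,
    Measure.finsetSum_apply, Fintype.sum_prod_type_right]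
  refine Finset.sum_congr rfl fun j _ => ?_
  rw [← h₂, ENNReal.ofReal_sum_of_nonneg fun j _ => hw _, Finset.sum_mul]
  refine Finset.sum_congr rfl fun i _ => ?_
  rw [Measure.smul_apply, ← univ_prod, Measure.prod_prod, smul_eq_mul,
    mul_comm (ProbabilityTheory.cond ν _ univ),
    ofReal_mul_cond_univ (hw _)]
  rw [← h₁]
  exact Finset.single_le_sum (f := fun j => w (i, j)) (fun i _ => hw _) (Finset.mem_univ j)

lemma lintegral_cellCoupling_le (hT : Measurable T) (g : ι → ι → ℝ≥0∞) :
    ∫⁻ z, g (T z.1) (T z.2) ∂cellCoupling T ν μ w ≤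
      ∑ z, ENNReal.ofReal (w z) * g z.1 z.2 := by
  rw [cellCoupling, lintegral_finsetSum_measure]
  refine Finset.sum_le_sum fun z _ => ?_
  rw [lintegral_smul_measure, smul_eq_mul]
  gcongr
  set P := ProbabilityTheory.cond ν (T ⁻¹' {z.1})
  set Q := ProbabilityTheory.cond μ (T ⁻¹' {z.2})
  have hP : ∀ᵐ y ∂P.prod Q, T y.1 = z.1 := Measure.quasiMeasurePreserving_fst.ae
    (ProbabilityTheory.ae_cond_mem (hT (measurableSet_singleton _)))
  have hQ : ∀ᵐ y ∂P.prod Q, T y.2 = z.2 := Measure.quasiMeasurePreserving_snd.ae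
    (ProbabilityTheory.ae_cond_mem (hT (measurableSet_singleton _)))
  have hle : ∀ (m : Measure X) [IsProbabilityMeasure m] (s : Set X),
      ProbabilityTheory.cond m s univ ≤ 1 := by
    intro m _ s
    by_cases h : m s = 0
    · simp [ProbabilityTheory.cond_eq_zero_of_meas_eq_zero h]
    · have := ProbabilityTheory.cond_isProbabilityMeasure h
      simp
  calc ∫⁻ y, g (T y.1) (T y.2) ∂P.prod Q = ∫⁻ _, g z.1 z.2 ∂P.prod Q := by
        refine lintegral_congr_ae ?_
        filter_upwards [hP, hQ] with y h1 h2
        rw [h1, h2]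
    _ = g z.1 z.2 * (P univ * Q univ) := by
        rw [lintegral_const, ← univ_prod_univ, Measure.prod_prod]
    _ ≤ g z.1 z.2 * (1 * 1) := by gcongr <;> exact hle _ _
    _ = g z.1 z.2 := by simp

lemma integral_comp_eq_sum (hT : Measurable T) (φ : ι → ℝ) :
    ∫ x, φ (T x) ∂μ = ∑ i, μ.real (T ⁻¹' {i}) * φ i := by
  have := Measure.isFiniteMeasure_map μ T
  rw [← integral_map (φ := T) hT.aemeasurable
    (measurable_of_countable φ).aestronglyMeasurable, integral_fintype .of_finite]
  refine Finset.sum_congr rfl fun i _ => ?_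
  rw [map_measureReal_apply hT (measurableSet_singleton i), smul_eq_mul]

lemma measureReal_preimage_mem_stdSimplex (hT : Measurable T) :
    (fun i => μ.real (T ⁻¹' {i})) ∈ stdSimplex ℝ ι := by
  refine ⟨fun i => measureReal_nonneg, ?_⟩
  have := integral_comp_eq_sum (μ := μ) hT fun _ => (1 : ℝ)
  simpa using this.symm

variable {Y : Type*} [MetricSpace Y] [MeasurableSpace Y] [BorelSpace Y] {S : Y → ι}
  {ρ σ : Measure Y} [IsProbabilityMeasure ρ] [IsProbabilityMeasure σ] {α : ℝ → ℝ}

/-- A dual bound controls the transport cost, up to the error made when the cost is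
replaced by a function of the cells of a finite measurable partition. -/
lemma transportCost_le_of_cells (hα : IsYoung α) (hS : Measurable S) {R ε : ℝ}
    (hdual : ∀ (f : Y → ℝ) (M : ℝ), Measurable f → (∀ x, |f x| ≤ M) →
      ∫ x, f x ∂ρ ≤ ∫ x, supConv α 1 f x ∂σ + R)
    {c : ι → ι → ℝ} (hc : ∀ i j, 0 ≤ c i j)
    (hlow : ∀ x y, c (S x) (S y) ≤ α (dist x y) + ε) {h : Y → ℝ≥0∞} (hh : Measurable h)
    (hupp : ∀ x y, ENNReal.ofReal (α (dist x y)) ≤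
      ENNReal.ofReal (c (S x) (S y)) + ENNReal.ofReal ε + (h x + h y)) :
    transportCost α ρ σ ≤ ENNReal.ofReal (R + ε) + ENNReal.ofReal ε +
      (∫⁻ x, h x ∂ρ + ∫⁻ x, h x ∂σ) := by
  classical
  obtain ⟨w, hw, hw₁, hw₂, hwc⟩ := exists_coupling_of_dual_le (R := R + ε)
    (measureReal_preimage_mem_stdSimplex (μ := ρ) hS)
    (measureReal_preimage_mem_stdSimplex (μ := σ) hS) c fun φ ψ hφψ => by
      obtain ⟨M, hM⟩ := (Set.finite_range fun i => |φ i|).bddAbove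
      have hb : ∀ x, |φ (S x)| ≤ M := fun x => hM ⟨S x, rfl⟩
      have hb' : ∀ x, |(φ ∘ S) x| ≤ M := hb
      have hψ : Measurable fun x => ψ (S x) := (measurable_of_countable ψ).comp hS
      obtain ⟨N, hN⟩ := (Set.finite_range fun i => |ψ i|).bddAbove
      have hψi : Integrable (fun x => ψ (S x)) σ := integrable_of_abs_le hψ fun x => hN ⟨S x, rfl⟩
      rw [← integral_comp_eq_sum hS, ← integral_comp_eq_sum hS]
      have h1 : ∫ x, supConv α 1 (φ ∘ S) x ∂σ ≤ ∫ x, (ψ (S x) + ε) ∂σ := by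
        refine integral_mono (integrable_of_abs_le (measurable_supConv hα hb' one_pos)
          (abs_supConv_le hα hb' zero_le_one)) (hψi.add (integrable_const ε)) fun x => ?_
        refine supConv_le x fun y => ?_
        have h2 := hφψ (S y) (S x)
        have h3 := hlow y x
        rw [dist_comm] at h3
        simp only [Function.comp_apply, one_mul]
        linarith
      rw [integral_add hψi (integrable_const ε)] at h1
      simp only [integral_const, probReal_univ, one_smul] at h1
      have h2 := hdual (φ ∘ S) M ((measurable_of_countable φ).comp hS) hb'
      simp only [Function.comp_apply] at h2
      linarith
  have hfst := map_fst_cellCoupling hS hw hw₁ hw₂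
  have hsnd := map_snd_cellCoupling hS hw hw₁ hw₂
  have hle : transportCost α ρ σ ≤
      ∫⁻ z, ENNReal.ofReal (α (dist z.1 z.2)) ∂cellCoupling S ρ σ w :=
    sInf_le ⟨cellCoupling S ρ σ w, hfst, hsnd, rfl⟩
  refine hle.trans ?_
  have huniv : cellCoupling S ρ σ w univ = 1 := by
    have := congrArg (fun m => m univ) hfst
    simpa [Measure.map_apply measurable_fst MeasurableSet.univ] using this
  have hm : Measurable fun z : Y × Y => ENNReal.ofReal (c (S z.1) (S z.2)) :=
    (measurable_of_countable fun z : ι × ι => ENNReal.ofReal (c z.1 z.2)).comp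
      ((hS.comp measurable_fst).prodMk (hS.comp measurable_snd))
  calc ∫⁻ z, ENNReal.ofReal (α (dist z.1 z.2)) ∂cellCoupling S ρ σ w
      ≤ ∫⁻ z, (ENNReal.ofReal (c (S z.1) (S z.2)) + ENNReal.ofReal ε + (h z.1 + h z.2))
          ∂cellCoupling S ρ σ w := lintegral_mono fun z => hupp z.1 z.2
    _ = ∫⁻ z, ENNReal.ofReal (c (S z.1) (S z.2)) ∂cellCoupling S ρ σ w + ENNReal.ofReal ε +
          (∫⁻ x, h x ∂ρ + ∫⁻ x, h x ∂σ) := by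
        have hh₁ : Measurable fun z : Y × Y => h z.1 := hh.comp measurable_fst
        rw [lintegral_add_left (hm.add_const _), lintegral_add_left hm,
          lintegral_add_left hh₁, lintegral_const, huniv, mul_one]
        congr 2
        · rw [← lintegral_map (f := h) hh measurable_fst, hfst]
        · rw [← lintegral_map (f := h) hh measurable_snd, hsnd]
    _ ≤ _ := by
        gcongr
        refine (lintegral_cellCoupling_le hS fun i j => ENNReal.ofReal (c i j)).trans ?_
        simp_rw [← ENNReal.ofReal_mul (hw _)]
        rw [← ENNReal.ofReal_sum_of_nonneg fun z _ => mul_nonneg (hw z) (hc _ _)]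
        exact ENNReal.ofReal_le_ofReal hwc

end Gluing

section Moments

variable {X : Type*} [MetricSpace X] {α : ℝ → ℝ}

lemma IsYoung.exists_apply_dist_le (hα : IsYoung α) (hΔ : DeltaTwo α) (X : Type*)
    [MetricSpace X] :
    ∃ D : ℝ, 1 ≤ D ∧ ∀ x y z : X, α (dist x z) ≤ D * (α (dist x y) + α (dist y z)) := by
  refine ⟨(1 / 2) ^ (-(pAlpha α - 1)), ?_, fun x y z => ?_⟩
  · exact Real.one_le_rpow_of_pos_of_le_one_of_nonpos (by norm_num) (by norm_num)
      (by linarith [hα.one_lt_pAlpha hΔ])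
  · refine (hα.le_of_le dist_nonneg (dist_triangle x y z)).trans
      ((hα.apply_add_le hΔ (w := 1 / 2) (by norm_num) (by norm_num) dist_nonneg
        dist_nonneg).trans (le_of_eq ?_))
    norm_num [mul_add]

lemma supConv_min_apply_dist_le (hα : IsYoung α) {D : ℝ} (hD : 1 ≤ D)
    (h : ∀ x y z : X, α (dist x z) ≤ D * (α (dist x y) + α (dist y z))) (o : X) (n : ℝ) (x : X) :
    supConv α 1 (fun y => min (D⁻¹ * α (dist y o)) n) x ≤ min (α (dist x o)) n := by
  refine supConv_le x fun y => ?_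
  have h0 := hα.nonneg (dist x y)
  have h1 : D⁻¹ * α (dist y o) ≤ α (dist y x) + α (dist x o) := by
    rw [inv_mul_le_iff₀ (by linarith)]
    exact h y x o
  rw [dist_comm y x] at h1
  refine le_min ?_ ?_
  · linarith [min_le_left (D⁻¹ * α (dist y o)) n]
  · linarith [min_le_right (D⁻¹ * α (dist y o)) n]

variable [MeasurableSpace X] [BorelSpace X] {μ : Measure X}

lemma IsYoung.measurable_apply_dist (hα : IsYoung α) (o : X) :
    Measurable fun x => α (dist x o) :=
  (hα.continuous.comp (continuous_id.dist continuous_const)).measurable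

lemma abs_min_natCast_le {v : ℝ} (hv : 0 ≤ v) (n : ℕ) : |min v n| ≤ n := by
  rw [abs_of_nonneg (le_min hv n.cast_nonneg)]
  exact min_le_right _ _

lemma lintegral_ofReal_le_of_forall_integral_min_le {Y : Type*} [MeasurableSpace Y]
    {m : Measure Y} [IsFiniteMeasure m] {V : Y → ℝ} (hV : Measurable V) (h0 : ∀ x, 0 ≤ V x)
    {L : ℝ} (h : ∀ n : ℕ, ∫ x, min (V x) n ∂m ≤ L) :
    ∫⁻ x, ENNReal.ofReal (V x) ∂m ≤ ENNReal.ofReal L := by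
  have hlim : ∀ x, liminf (fun n : ℕ => ENNReal.ofReal (min (V x) n)) atTop =
      ENNReal.ofReal (V x) := by
    intro x
    refine (tendsto_const_nhds.congr' ?_).liminf_eq
    filter_upwards [eventually_ge_atTop ⌈V x⌉₊] with n hn
    rw [min_eq_left ((Nat.le_ceil _).trans (Nat.cast_le.2 hn))]
  simp_rw [← hlim]
  refine (lintegral_liminf_le fun n => (hV.min measurable_const).ennreal_ofReal).trans ?_
  refine liminf_le_of_le (by isBoundedDefault) fun b hb => ?_
  obtain ⟨n, hn⟩ := hb.exists
  refine hn.trans ?_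
  rw [← ofReal_integral_eq_lintegral_ofReal]
  · exact ENNReal.ofReal_le_ofReal (h n)
  · exact .of_bound (hV.min measurable_const).aestronglyMeasurable n
      (.of_forall fun x => abs_min_natCast_le (h0 x) n)
  · exact .of_forall fun x => le_min (h0 x) n.cast_nonneg

lemma exists_measure_compl_closedBall_le [ProperSpace X] (m : Measure X)
    [IsFiniteMeasure m] (o : X) {ε : ℝ≥0∞} (hε : 0 < ε) :
    ∃ r : ℝ, 0 ≤ r ∧ m (Metric.closedBall o r)ᶜ ≤ ε := by
  obtain ⟨K, hK, hKm⟩ := isTightMeasureSet_iff_exists_isCompact_measure_compl_le.1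
    (isTightMeasureSet_singleton (μ := m)) ε hε
  obtain ⟨r, hr, hKr⟩ := hK.isBounded.subset_closedBall_lt 0 o
  exact ⟨r, hr.le, (measure_mono (compl_subset_compl.2 hKr)).trans (hKm m rfl)⟩

/-- If the log-Laplace transform of `g` is at most linear in its mean and `g` is bounded outside
a set of small measure, then the mean of `g` is bounded. -/
lemma setIntegral_le_of_log_integral_exp_le {Y : Type*} [MeasurableSpace Y] {m : Measure Y}
    [IsProbabilityMeasure m] {g : Y → ℝ} (hg : Measurable g) {M θ k b : ℝ}
    (hM : ∀ x, |g x| ≤ M) {E : Set Y} (hE : MeasurableSet E) (hgE : ∀ x ∈ Eᶜ, g x ≤ b)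
    (hg0 : ∀ x, 0 ≤ g x) (hb : 0 ≤ b) (hk : 0 < k) (hmE : 2 * m.real E ≤ θ) (hE0 : 0 < m.real E)
    (h : Real.log (∫ x, Real.exp (k * (θ * g x)) ∂m) ≤ k * ∫ x, g x ∂m) :
    ∫ x, g x ∂m ≤ b + (b - Real.log (m.real E) / k) := by
  have hgi : Integrable g m := integrable_of_abs_le hg hM
  set z := ∫ x in E, g x ∂m with hz
  have hz0 : 0 ≤ z := setIntegral_nonneg hE fun x _ => hg0 x
  have hsplit : ∫ x, g x ∂m ≤ b + z := by
    rw [← integral_add_compl hE hgi, add_comm]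
    gcongr
    calc ∫ x in Eᶜ, g x ∂m ≤ ∫ x in Eᶜ, b ∂m :=
          setIntegral_mono_on hgi.integrableOn (integrable_const b).integrableOn hE.compl hgE
      _ = m.real Eᶜ * b := by simp
      _ ≤ 1 * b := by gcongr; exact measureReal_le_one
      _ = b := one_mul b
  set t := k * (θ * z) / m.real E with ht
  have hexp : Integrable (fun x => Real.exp (k * (θ * g x))) m := by
    refine integrable_exp_of_abs_le (M := |k * θ| * M) ((hg.const_mul θ).const_mul k) fun x => ?_
    rw [← mul_assoc, abs_mul]
    gcongr
    exact hM x
  have hjensen : m.real E * Real.exp t ≤ ∫ x, Real.exp (k * (θ * g x)) ∂m := by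
    calc m.real E * Real.exp t
        = ∫ x in E, Real.exp t * ((1 - t) + k * (θ * g x)) ∂m := by
          rw [integral_const_mul, integral_add (integrable_const _)
            ((hgi.integrableOn.const_mul θ).const_mul k), integral_const_mul,
            integral_const_mul, ← hz, integral_const, measureReal_restrict_apply_univ,
            smul_eq_mul]
          have : k * (θ * z) = t * m.real E := by rw [ht, div_mul_cancel₀ _ hE0.ne']
          rw [this]
          ring
      _ ≤ ∫ x in E, Real.exp (k * (θ * g x)) ∂m := by
          refine setIntegral_mono ?_ hexp.integrableOn fun x => ?_
          · exact ((integrable_const _).add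
              ((hgi.integrableOn.const_mul θ).const_mul k)).const_mul _
          · have := Real.add_one_le_exp (k * (θ * g x) - t)
            calc Real.exp t * ((1 - t) + k * (θ * g x))
                ≤ Real.exp t * Real.exp (k * (θ * g x) - t) := by
                  gcongr; linarith
              _ = Real.exp (k * (θ * g x)) := by rw [← Real.exp_add]; ring_nf
      _ ≤ ∫ x, Real.exp (k * (θ * g x)) ∂m :=
          setIntegral_le_integral hexp (.of_forall fun x => (Real.exp_pos _).le)
  have hlog := Real.log_le_log (by positivity) hjensen
  rw [Real.log_mul hE0.ne' (Real.exp_pos t).ne', Real.log_exp] at hlog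
  have h2 : 2 * (k * z) ≤ t := by
    rw [ht, le_div_iff₀ hE0]
    have : k * z * (2 * m.real E) ≤ k * z * θ := by gcongr
    linarith
  have h3 : k * ∫ x, g x ∂m ≤ k * (b + z) := by gcongr
  have h4 : z ≤ b - Real.log (m.real E) / k := by
    rw [le_sub_iff_add_le, ← le_sub_iff_add_le', div_le_iff₀ hk]
    linarith
  linarith

variable [IsProbabilityMeasure μ]

lemma exists_forall_integral_min_le [ProperSpace X] (hα : IsYoung α) (hΔ : DeltaTwo α)
    {k : ℝ} (hk : 0 < k)
    (hdual : ∀ (f : X → ℝ) (M : ℝ), Measurable f → (∀ x, |f x| ≤ M) →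
      Real.log (∫ x, Real.exp (k * f x) ∂μ) ≤ k * ∫ x, supConv α 1 f x ∂μ) (o : X) :
    ∃ L : ℝ, ∀ n : ℕ, ∫ x, min (α (dist x o)) n ∂μ ≤ L := by
  obtain ⟨D, hD, hDα⟩ := hα.exists_apply_dist_le hΔ X
  have hD0 : 0 < D := by linarith
  have hVm := hα.measurable_apply_dist o
  have hV0 : ∀ x, 0 ≤ α (dist x o) := fun x => hα.nonneg _
  obtain ⟨r, hr, hrm⟩ := exists_measure_compl_closedBall_le μ o
    (ε := ENNReal.ofReal (D⁻¹ / 2)) (by rw [ENNReal.ofReal_pos]; positivity)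
  set E := (Metric.closedBall o r)ᶜ with hE
  have hEm : MeasurableSet E := Metric.isClosed_closedBall.measurableSet.compl
  have hVE : ∀ x ∈ Eᶜ, α (dist x o) ≤ α r := fun x hx => by
    rw [hE, compl_compl] at hx
    exact hα.le_of_le dist_nonneg hx
  have hgm : ∀ n : ℕ, Measurable fun x => min (α (dist x o)) n :=
    fun n => hVm.min measurable_const
  have hgb : ∀ (n : ℕ) x, |min (α (dist x o)) n| ≤ n := fun n x => abs_min_natCast_le (hV0 x) n
  rcases (measureReal_nonneg (μ := μ) (s := E)).eq_or_lt with h0 | h0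
  · refine ⟨α r, fun n => ?_⟩
    have hE0 : μ E = 0 := (measureReal_eq_zero_iff).1 h0.symm
    calc ∫ x, min (α (dist x o)) n ∂μ ≤ ∫ _, α r ∂μ := by
          refine integral_mono_ae (integrable_of_abs_le (hgm n) (hgb n)) (integrable_const _) ?_
          filter_upwards [compl_mem_ae_iff.2 hE0] with x hx
          exact (min_le_left _ _).trans (hVE x hx)
      _ = α r := by simp
  · refine ⟨α r + (α r - Real.log (μ.real E) / k), fun n => ?_⟩
    refine setIntegral_le_of_log_integral_exp_le (θ := D⁻¹) (hgm n) (hgb n) hEm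
      (fun x hx => (min_le_left _ _).trans (hVE x hx)) (fun x => le_min (hV0 x) n.cast_nonneg)
      (hα.nonneg r) hk ?_ h0 ?_
    · have : μ.real E ≤ D⁻¹ / 2 := ENNReal.toReal_le_of_le_ofReal (by positivity) hrm
      linarith
    · set f : X → ℝ := fun y => min (D⁻¹ * α (dist y o)) n
      have hfm : Measurable f := (hVm.const_mul _).min measurable_const
      have hfb : ∀ x, |f x| ≤ n := fun x =>
        abs_min_natCast_le (mul_nonneg (inv_nonneg.2 hD0.le) (hV0 x)) n
      have hkf : ∀ x, |k * f x| ≤ k * n := fun x => by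
        rw [abs_mul, abs_of_pos hk]; gcongr; exact hfb x
      have hkg : ∀ x, |k * (D⁻¹ * min (α (dist x o)) n)| ≤ k * (D⁻¹ * n) := fun x => by
        rw [abs_mul, abs_of_pos hk, abs_mul, abs_of_pos (inv_pos.2 hD0)]
        gcongr; exact hgb n x
      have hi₁ : Integrable (fun x => Real.exp (k * (D⁻¹ * min (α (dist x o)) n))) μ :=
        integrable_exp_of_abs_le (((hgm n).const_mul _).const_mul _) hkg
      calc Real.log (∫ x, Real.exp (k * (D⁻¹ * min (α (dist x o)) n)) ∂μ)
          ≤ Real.log (∫ x, Real.exp (k * f x) ∂μ) := by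
            refine Real.log_le_log (integral_exp_pos hi₁) (integral_mono hi₁
              (integrable_exp_of_abs_le (hfm.const_mul k) hkf) fun x => ?_)
            refine Real.exp_le_exp.2 (mul_le_mul_of_nonneg_left (le_min ?_ ?_) hk.le)
            · exact mul_le_mul_of_nonneg_left (min_le_left _ _) (inv_nonneg.2 hD0.le)
            · exact (mul_le_of_le_one_left (le_min (hV0 x) n.cast_nonneg)
                (inv_le_one_of_one_le₀ hD)).trans (min_le_right _ _)
        _ ≤ k * ∫ x, supConv α 1 f x ∂μ := hdual f n hfm hfb
        _ ≤ k * ∫ x, min (α (dist x o)) n ∂μ := by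
            refine mul_le_mul_of_nonneg_left (integral_mono
              (integrable_of_abs_le (measurable_supConv hα hfb one_pos)
                (abs_supConv_le hα hfb zero_le_one)) (integrable_of_abs_le (hgm n) (hgb n))
              (supConv_min_apply_dist_le hα hD hDα o n)) hk.le

/-- Finiteness of the moments of both measures in a dual transport inequality. -/
lemma lintegral_apply_dist_lt_top (hα : IsYoung α) (hΔ : DeltaTwo α) {ν : Measure X}
    [IsProbabilityMeasure ν] {R : ℝ}
    (hdual : ∀ (f : X → ℝ) (M : ℝ), Measurable f → (∀ x, |f x| ≤ M) →
      ∫ x, f x ∂ν ≤ ∫ x, supConv α 1 f x ∂μ + R) {o : X} {L : ℝ}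
    (hL : ∀ n : ℕ, ∫ x, min (α (dist x o)) n ∂μ ≤ L) :
    ∫⁻ x, ENNReal.ofReal (α (dist x o)) ∂μ < ∞ ∧
      ∫⁻ x, ENNReal.ofReal (α (dist x o)) ∂ν < ∞ := by
  obtain ⟨D, hD, hDα⟩ := hα.exists_apply_dist_le hΔ X
  have hD0 : 0 < D := by linarith
  have hVm := hα.measurable_apply_dist o
  have hV0 : ∀ x, 0 ≤ α (dist x o) := fun x => hα.nonneg _
  refine ⟨(lintegral_ofReal_le_of_forall_integral_min_le hVm hV0 hL).trans_lt
    ENNReal.ofReal_lt_top, ?_⟩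
  have hθ0 : ∀ x, 0 ≤ D⁻¹ * α (dist x o) := fun x => mul_nonneg (inv_nonneg.2 hD0.le) (hV0 x)
  have h := lintegral_ofReal_le_of_forall_integral_min_le (m := ν) (L := L + R)
    (hVm.const_mul D⁻¹) hθ0 fun n => by
      have hb : ∀ x, |min (D⁻¹ * α (dist x o)) n| ≤ n := fun x => abs_min_natCast_le (hθ0 x) n
      refine (hdual _ n ((hVm.const_mul D⁻¹).min measurable_const) hb).trans ?_
      gcongr
      refine (integral_mono (integrable_of_abs_le (measurable_supConv hα hb one_pos)
        (abs_supConv_le hα hb zero_le_one)) (integrable_of_abs_le (hVm.min measurable_const)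
        fun x => abs_min_natCast_le (hV0 x) n)
        (supConv_min_apply_dist_le hα hD hDα o n)).trans (hL n)
  simp_rw [ENNReal.ofReal_mul (inv_nonneg.2 hD0.le)] at h
  rw [lintegral_const_mul _ hVm.ennreal_ofReal] at h
  refine ENNReal.lt_top_of_mul_ne_top_right (h.trans_lt ENNReal.ofReal_lt_top).ne ?_
  simpa using hD0

end Moments

section Kantorovich

variable {X : Type*} [MetricSpace X] [MeasurableSpace X] [BorelSpace X] {α : ℝ → ℝ}

lemma exists_measurable_nat_dist_lt [TopologicalSpace.SeparableSpace X] [Nonempty X] {K : Set X}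
    (hK : IsCompact K) {δ : ℝ} (hδ : 0 < δ) :
    ∃ (N : ℕ) (e : ℕ → X) (T : X → ℕ), Measurable T ∧ (∀ x, T x ≤ N) ∧
      ∀ x ∈ K, dist x (e (T x)) < δ := by
  set e := TopologicalSpace.denseSeq X
  obtain ⟨t, ht⟩ := hK.elim_finite_subcover (fun n => Metric.ball (e n) δ)
    (fun n => Metric.isOpen_ball) fun x _ => by
      obtain ⟨n, hn⟩ := (TopologicalSpace.denseRange_denseSeq X).exists_dist_lt x hδ
      exact mem_iUnion.2 ⟨n, hn⟩
  refine ⟨t.sup id, e, SimpleFunc.nearestPtInd e (t.sup id), SimpleFunc.measurable _,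
    fun x => SimpleFunc.nearestPtInd_le e _ x, fun x hx => ?_⟩
  obtain ⟨n, hn⟩ := mem_iUnion.1 (ht hx)
  obtain ⟨hnt, hxn⟩ := mem_iUnion.1 hn
  have h : edist (e (SimpleFunc.nearestPtInd e (t.sup id) x)) x ≤ edist (e n) x :=
    SimpleFunc.edist_nearestPt_le e x (Finset.le_sup (f := id) hnt)
  rw [edist_dist, edist_dist, ENNReal.ofReal_le_ofReal_iff dist_nonneg] at h
  rw [dist_comm]
  exact h.trans_lt (by rw [dist_comm]; exact hxn)

variable {ν μ : Measure X} [IsProbabilityMeasure ν] [IsProbabilityMeasure μ]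

lemma exists_setLIntegral_compl_closedBall_lt [ProperSpace X] (o : X) {g : X → ℝ≥0∞}
    (hμ : ∫⁻ x, g x ∂μ < ∞) (hν : ∫⁻ x, g x ∂ν < ∞) {ε : ℝ≥0∞} (hε : ε ≠ 0) :
    ∃ r : ℝ, 0 ≤ r ∧ ∫⁻ x in (Metric.closedBall o r)ᶜ, g x ∂ν +
      ∫⁻ x in (Metric.closedBall o r)ᶜ, g x ∂μ < ε := by
  have hfin : ∫⁻ x, g x ∂(ν + μ) ≠ ∞ := by
    rw [lintegral_add_measure]
    exact (ENNReal.add_lt_top.2 ⟨hν, hμ⟩).ne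
  obtain ⟨δ, hδ, h⟩ := exists_pos_setLIntegral_lt_of_measure_lt hfin hε
  obtain ⟨δ', hδ', hδδ'⟩ := exists_between hδ
  obtain ⟨r, hr, hrm⟩ := exists_measure_compl_closedBall_le (ν + μ) o hδ'
  refine ⟨r, hr, ?_⟩
  have := h _ (hrm.trans_lt hδδ')
  rwa [Measure.restrict_add, lintegral_add_measure] at this

/-- Kantorovich duality for the cost `α (dist x y)`, under finiteness of the moments. -/
lemma transportCost_le_of_dual [ProperSpace X] (hα : IsYoung α) (hΔ : DeltaTwo α) {R : ℝ}
    (hdual : ∀ (f : X → ℝ) (M : ℝ), Measurable f → (∀ x, |f x| ≤ M) →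
      ∫ x, f x ∂ν ≤ ∫ x, supConv α 1 f x ∂μ + R) {o : X}
    (hμ : ∫⁻ x, ENNReal.ofReal (α (dist x o)) ∂μ < ∞)
    (hν : ∫⁻ x, ENNReal.ofReal (α (dist x o)) ∂ν < ∞) :
    transportCost α ν μ ≤ ENNReal.ofReal R := by
  have : Nonempty X := ⟨o⟩
  obtain ⟨D, hD, hDα⟩ := hα.exists_apply_dist_le hΔ X
  have hVm := hα.measurable_apply_dist o
  set g : X → ℝ≥0∞ := fun x => ENNReal.ofReal (2 * D) * ENNReal.ofReal (α (dist x o)) with hg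
  have hgm : Measurable g := hVm.ennreal_ofReal.const_mul _
  have hgfin : ∀ m : Measure X, ∫⁻ x, ENNReal.ofReal (α (dist x o)) ∂m < ∞ →
      ∫⁻ x, g x ∂m < ∞ := fun m hm => by
    rw [hg, lintegral_const_mul _ hVm.ennreal_ofReal]
    exact ENNReal.mul_lt_top ENNReal.ofReal_lt_top hm
  have hlim : Tendsto (fun ε : ℝ => ENNReal.ofReal (R + ε) + ENNReal.ofReal ε +
      ENNReal.ofReal ε) (𝓝[>] 0) (𝓝 (ENNReal.ofReal R)) := by
    have : Continuous fun ε : ℝ => ENNReal.ofReal (R + ε) + ENNReal.ofReal ε +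
        ENNReal.ofReal ε :=
      ((ENNReal.continuous_ofReal.comp (continuous_const.add continuous_id)).add
        ENNReal.continuous_ofReal).add ENNReal.continuous_ofReal
    have := this.tendsto 0
    simp only [add_zero, ENNReal.ofReal_zero] at this
    exact this.mono_left nhdsWithin_le_nhds
  refine ge_of_tendsto hlim ?_
  filter_upwards [self_mem_nhdsWithin] with ε hε
  rw [mem_Ioi] at hε
  obtain ⟨r, hr, hrε⟩ := exists_setLIntegral_compl_closedBall_lt o (hgfin μ hμ) (hgfin ν hν)
    (ENNReal.ofReal_pos.2 hε).ne'
  set E := (Metric.closedBall o r)ᶜ with hE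
  have hEm : MeasurableSet E := Metric.isClosed_closedBall.measurableSet.compl
  obtain ⟨δ, hδ, hδα⟩ := Metric.uniformContinuousOn_iff.1
    ((isCompact_Icc (a := (0 : ℝ)) (b := 2 * r + 1)).uniformContinuousOn_of_continuous
      hα.continuous.continuousOn) ε hε
  obtain ⟨N, e, T, hT, hTN, hTd⟩ := exists_measurable_nat_dist_lt
    (isCompact_closedBall o r) (δ := min δ 1 / 2) (by positivity)
  classical
  set S : X → Fin (N + 2) := fun x => Fin.ofNat (N + 2) (if x ∈ E then N + 1 else T x) with hS
  have hSm : Measurable S :=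
    (measurable_of_countable (Fin.ofNat (N + 2))).comp (Measurable.ite hEm measurable_const hT)
  set c : Fin (N + 2) → Fin (N + 2) → ℝ := fun i j =>
    if i.val = N + 1 ∨ j.val = N + 1 then 0 else α (dist (e i) (e j)) with hc
  have hSE : ∀ x ∈ E, (S x).val = N + 1 := fun x hx => by
    simp [hS, hx]
  have hSE' : ∀ x ∉ E, (S x).val = T x := fun x hx => by
    have := hTN x
    simp [hS, hx, Nat.mod_eq_of_lt (show T x < N + 2 by omega)]
  have hfar : ∀ x y, x ∈ E ∨ y ∈ E → c (S x) (S y) = 0 := fun x y h => by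
    rw [hc]
    exact if_pos (h.imp (hSE x) (hSE y))
  have hnear : ∀ x y, x ∉ E → y ∉ E → |c (S x) (S y) - α (dist x y)| < ε := by
    intro x y hx hy
    have hxT := hTN x
    have hyT := hTN y
    have hcxy : c (S x) (S y) = α (dist (e (T x)) (e (T y))) := by
      simp only [hc, hSE' x hx, hSE' y hy]
      exact if_neg (by omega)
    rw [hE, notMem_compl_iff] at hx hy
    have hdx := hTd x hx
    have hdy := hTd y hy
    have hdd : |dist (e (T x)) (e (T y)) - dist x y| < min δ 1 := by
      have h1 := dist_triangle4 (e (T x)) x y (e (T y))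
      have h2 := dist_triangle4 x (e (T x)) (e (T y)) y
      rw [dist_comm (e (T x)) x] at h1
      rw [dist_comm (e (T y)) y] at h2
      rw [abs_lt]
      constructor <;> linarith
    have hxy : dist x y ≤ 2 * r := by
      have := dist_triangle_right x y o
      rw [Metric.mem_closedBall] at hx hy
      linarith
    rw [hcxy]
    refine hδα _ ⟨dist_nonneg, ?_⟩ _ ⟨dist_nonneg, by linarith⟩ (hdd.trans_le (min_le_left _ _))
    linarith [(abs_lt.1 (hdd.trans_le (min_le_right _ _))).2]
  have hgE : ∀ x y, dist y o ≤ dist x o → ENNReal.ofReal (α (dist x y)) ≤ g x := by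
    intro x y hyx
    simp only [hg]
    rw [← ENNReal.ofReal_mul (by linarith)]
    refine ENNReal.ofReal_le_ofReal ((hDα x o y).trans ?_)
    rw [dist_comm o y, mul_comm 2 D, mul_assoc]
    have := hα.le_of_le dist_nonneg hyx
    gcongr
    linarith
  have key := transportCost_le_of_cells hα hSm (ε := ε) hdual (c := c)
    (fun i j => by rw [hc]; dsimp only; split_ifs; exacts [le_rfl, hα.nonneg _])
    (fun x y => by
      by_cases h : x ∈ E ∨ y ∈ E
      · rw [hfar x y h]
        linarith [hα.nonneg (dist x y)]
      · rw [not_or] at h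
        linarith [(abs_lt.1 (hnear x y h.1 h.2)).2])
    (hgm.indicator hEm) fun x y => by
      by_cases h : x ∈ E ∨ y ∈ E
      · refine le_add_left ?_
        rcases le_total (dist y o) (dist x o) with hyx | hyx
        · have hx : x ∈ E := h.elim id fun hy => by
            rw [hE, mem_compl_iff, Metric.mem_closedBall] at hy ⊢
            linarith
          refine le_add_right ?_
          rw [indicator_of_mem hx]
          exact hgE x y hyx
        · have hy : y ∈ E := h.symm.elim id fun hx => by
            rw [hE, mem_compl_iff, Metric.mem_closedBall] at hx ⊢
            linarith
          refine le_add_left ?_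
          rw [indicator_of_mem hy, dist_comm]
          exact hgE y x hyx
      · rw [not_or] at h
        refine le_add_right ?_
        have h1 := (abs_lt.1 (hnear x y h.1 h.2)).1
        refine (ENNReal.ofReal_le_ofReal (q := c (S x) (S y) + ε) (by linarith)).trans
          ENNReal.ofReal_add_le
  rw [lintegral_indicator hEm, lintegral_indicator hEm] at key
  exact key.trans (add_le_add_right hrε.le _)

end Kantorovich

/-- The variational bound of Donsker and Varadhan. -/
lemma integral_le_integral_llr_add_log_integral_exp {X : Type*} [MeasurableSpace X]
    {ν μ : Measure X} [IsProbabilityMeasure ν] [IsProbabilityMeasure μ] (hνμ : ν ≪ μ)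
    (hint : Integrable (llr ν μ) ν) {g : X → ℝ} {M : ℝ} (hg : Measurable g)
    (hM : ∀ x, |g x| ≤ M) :
    ∫ x, g x ∂ν ≤ ∫ x, llr ν μ x ∂ν + Real.log (∫ x, Real.exp (g x) ∂μ) := by
  have hgν : Integrable g ν := integrable_of_abs_le hg hM
  have hexp : Integrable (fun x => Real.exp (g x)) μ := integrable_exp_of_abs_le hg hM
  have := isProbabilityMeasure_tilted hexp
  have h := InformationTheory.integral_llr_add_sub_measure_univ_nonneg
    (hνμ.trans (absolutelyContinuous_tilted hexp))
    (integrable_llr_tilted_right hνμ hgν hint hexp)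
  rw [integral_llr_tilted_right hνμ hgν hexp hint] at h
  simp only [probReal_univ] at h
  linarith

lemma add_mul_rpow_le {p B : ℝ} (hp : 1 < p) (hB : 1 ≤ B) :
    (p + B * (p * ((1 - 1 / p) ^ (-(p - 1)) - 1))) ^ (p - 1) ≤
      p ^ (p * (p - 1)) / (p - 1) ^ ((p - 1) * (p - 1)) * B ^ (p - 1) := by
  have hp0 : 0 < p := by linarith
  have hq : 0 < p - 1 := by linarith
  have hr : 1 - 1 / p = (p - 1) / p := by field_simp
  have hr0 : 0 < (p - 1) / p := by positivity
  have hr1 : (p - 1) / p ≤ 1 := by rw [div_le_one hp0]; linarith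
  rw [hr]
  have hG : 1 ≤ ((p - 1) / p) ^ (-(p - 1)) :=
    Real.one_le_rpow_of_pos_of_le_one_of_nonpos hr0 hr1 (by linarith)
  set G := ((p - 1) / p) ^ (-(p - 1)) with hGdef
  have hGq : G ^ (p - 1) = p ^ ((p - 1) * (p - 1)) / (p - 1) ^ ((p - 1) * (p - 1)) := by
    rw [hGdef, ← Real.rpow_mul hr0.le, neg_mul, Real.rpow_neg hr0.le, ← Real.inv_rpow hr0.le,
      inv_div, Real.div_rpow hp0.le hq.le]
  calc (p + B * (p * (G - 1))) ^ (p - 1) ≤ (p * (B * G)) ^ (p - 1) := by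
        have h0 : 0 ≤ B * (p * (G - 1)) := by
          have : 0 ≤ G - 1 := by linarith
          positivity
        refine Real.rpow_le_rpow (by linarith) ?_ hq.le
        have : p * 1 ≤ p * B := by gcongr
        linarith
    _ = _ := by
        rw [Real.mul_rpow hp0.le (by positivity), Real.mul_rpow (by linarith) (by linarith), hGq]
        have : p ^ (p * (p - 1)) = p ^ (p - 1) * p ^ ((p - 1) * (p - 1)) := by
          rw [← Real.rpow_add hp0]
          ring_nf
        rw [this]
        ring

theorem tau_lsi_implies_transport_entropy
    {X : Type*} [MetricSpace X] [CompleteSpace X] [TopologicalSpace.SeparableSpace X]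
    [ProperSpace X] [MeasurableSpace X] [BorelSpace X]
    (α : ℝ → ℝ) (hα : IsYoung α) (hΔ : DeltaTwo α)
    (μ : Measure X) [IsProbabilityMeasure μ] (A : ℝ) (hA : 0 < A)
    (hLSI : TauLSI μ α 1 A) :
    TransportEntropy μ α
      ((pAlpha α ^ (pAlpha α * (pAlpha α - 1)) /
          (pAlpha α - 1) ^ ((pAlpha α - 1) * (pAlpha α - 1))) *
        max A 1 ^ (pAlpha α - 1)) := by
  have hp : 1 < pAlpha α := hα.one_lt_pAlpha hΔ
  set p := pAlpha α with hpdef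
  have hq : 0 < p - 1 := by linarith
  have hp0 : 0 < p := by linarith
  have hB : 1 ≤ max A 1 := le_max_right A 1
  have hB0 : 0 < max A 1 := by linarith
  have hLSI' : TauLSI μ α 1 (max A 1) := hLSI.mono hα (le_max_left A 1)
  have hC := add_mul_rpow_le hp hB
  have hC0 : 0 < p ^ (p * (p - 1)) / (p - 1) ^ ((p - 1) * (p - 1)) * max A 1 ^ (p - 1) := by
    positivity
  set C := p ^ (p * (p - 1)) / (p - 1) ^ ((p - 1) * (p - 1)) * max A 1 ^ (p - 1)
  set a := max A 1 * (p * ((1 - 1 / p) ^ (-(p - 1)) - 1)) with ha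
  have ha0 : 0 ≤ a := by
    have h1 : 0 < 1 - 1 / p := by rw [sub_pos, div_lt_one hp0]; exact hp
    have h2 : 1 - 1 / p ≤ 1 := by
      have : 0 < 1 / p := by positivity
      linarith
    have h3 := Real.one_le_rpow_of_pos_of_le_one_of_nonpos h1 h2 (by linarith : -(p - 1) ≤ 0)
    exact mul_nonneg hB0.le (mul_nonneg hp0.le (by linarith))
  have hs : 0 < (p + a)⁻¹ := by positivity
  set k := (p + a)⁻¹ ^ (p - 1) with hk
  have hk0 : 0 < k := Real.rpow_pos_of_pos hs _
  have hkC : k⁻¹ ≤ C := by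
    rwa [hk, Real.inv_rpow (by linarith), inv_inv]
  have hdual : ∀ (f : X → ℝ) (M : ℝ), Measurable f → (∀ x, |f x| ≤ M) →
      Real.log (∫ x, Real.exp (k * f x) ∂μ) ≤ k * ∫ x, supConv α 1 f x ∂μ :=
    fun f M hfm hf => hLSI'.log_integral_exp_le hα hΔ hB0 hfm hf ha hs
      (inv_mul_cancel₀ (by linarith)) ha0
  intro ν hν
  by_cases hfin : ν ≪ μ ∧ Integrable (fun x => Real.log (ν.rnDeriv μ x).toReal) ν
  swap
  · rw [relEnt, if_neg hfin, ENNReal.mul_top (ENNReal.ofReal_pos.2 hC0).ne']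
    exact le_top
  rw [relEnt, if_pos hfin, ← ENNReal.ofReal_mul hC0.le]
  obtain ⟨hνμ, hint⟩ := hfin
  have hH0 : 0 ≤ ∫ x, llr ν μ x ∂ν := by
    have := InformationTheory.integral_llr_add_sub_measure_univ_nonneg hνμ hint
    simpa using this
  have hdual' : ∀ (f : X → ℝ) (M : ℝ), Measurable f → (∀ x, |f x| ≤ M) →
      ∫ x, f x ∂ν ≤ ∫ x, supConv α 1 f x ∂μ + k⁻¹ * ∫ x, llr ν μ x ∂ν := by
    intro f M hfm hf
    have h := integral_le_integral_llr_add_log_integral_exp hνμ hint (g := fun x => k * f x)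
      (M := k * M) (hfm.const_mul k) fun x => by
        rw [abs_mul, abs_of_pos hk0]
        gcongr
        exact hf x
    rw [integral_const_mul] at h
    rw [← mul_le_mul_iff_right₀ hk0, mul_add, mul_inv_cancel_left₀ hk0.ne']
    linarith [hdual f M hfm hf]
  obtain ⟨o⟩ : Nonempty X := μ.nonempty_of_neZero
  obtain ⟨L, hL⟩ := exists_forall_integral_min_le hα hΔ hk0 hdual o
  obtain ⟨hμo, hνo⟩ := lintegral_apply_dist_lt_top hα hΔ hdual' hL
  refine (transportCost_le_of_dual hα hΔ hdual' hμo hνo).trans (ENNReal.ofReal_le_ofReal ?_)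
  exact mul_le_mul_of_nonneg_right hkC hH0
end

section
/- Let (X,d) be a complete separable metric space in which closed balls are compact, let p > 1 and q = p/(p−1). For every n ∈ ℕ*, every L > 0, every bounded continuous (L,p)-Lipschitz function f : X^n → ℝ, and every x ∈ X^n, the function y ↦ f(y) − Σ_{i=1}^n d(x_i,y_i)^p attains its maximum over X^n at some point y with Σ_{i=1}^n d(x_i,y_i)^p ≤ L^q. If moreover (X,d) is geodesic, the maximum is attained at some point y with Σ_{i=1}^n d(x_i,y_i)^p ≤ (L/p)^q. -/
open MeasureTheory Filter Set Topology
open scoped ENNReal NNReal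

/-- A geodesic metric space. -/
def IsGeodesicSpace (X : Type*) [MetricSpace X] : Prop :=
  ∀ x y : X, ∃ z : ℝ → X, z 0 = x ∧ z 1 = y ∧
    ∀ s ∈ Set.Icc (0:ℝ) 1, ∀ t ∈ Set.Icc (0:ℝ) 1, dist (z s) (z t) = |s - t| * dist x y

/-- The growth bound `c S ≤ L S^{1/p}` confines `S` to `[0, (L/c)^{p/(p-1)}]`. -/
theorem le_rpow_conjExponent_of_mul_le {p c L S : ℝ} (hp : 1 < p) (hc : 0 < c) (hL : 0 ≤ L)
    (hS : 0 ≤ S) (h : c * S ≤ L * S ^ (1 / p)) : S ≤ (L / c) ^ (p / (p - 1)) := by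
  rcases hS.eq_or_lt with rfl | hS
  · positivity
  have hp0 : 0 < p := by linarith
  have hp1 : 0 < p - 1 := by linarith
  have hsplit : S = S ^ ((p - 1) / p) * S ^ (1 / p) := by
    rw [← Real.rpow_add hS]
    conv_lhs => rw [← Real.rpow_one S]
    congr 1
    field_simp
    ring
  have hbound : S ^ ((p - 1) / p) ≤ L / c := by
    rw [le_div_iff₀ hc]
    have hpos : 0 < S ^ (1 / p) := by positivity
    refine le_of_mul_le_mul_right ?_ hpos
    calc S ^ ((p - 1) / p) * c * S ^ (1 / p)
        = c * (S ^ ((p - 1) / p) * S ^ (1 / p)) := by ring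
      _ = c * S := by rw [← hsplit]
      _ ≤ L * S ^ (1 / p) := h
  calc S = (S ^ ((p - 1) / p)) ^ (p / (p - 1)) := by
        rw [← Real.rpow_mul hS.le]
        conv_lhs => rw [← Real.rpow_one S]
        congr 1
        field_simp
    _ ≤ (L / c) ^ (p / (p - 1)) := by gcongr

/-- Dividing by `1 - t` and letting `t → 1` in a bound on `1 - t ^ p`. -/
theorem mul_le_of_forall_mul_one_sub_rpow_le {p S B : ℝ}
    (h : ∀ t ∈ Ico (0 : ℝ) 1, S * (1 - t ^ p) ≤ B * (1 - t)) : p * S ≤ B := by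
  have hderiv : HasDerivAt (fun t : ℝ => t ^ p) p 1 := by
    simpa using Real.hasDerivAt_rpow_const (x := 1) (p := p) (Or.inl one_ne_zero)
  have hslope : Tendsto (slope (fun t : ℝ => t ^ p) 1) (𝓝[<] 1) (𝓝 p) :=
    (hasDerivAt_iff_tendsto_slope.1 hderiv).mono_left
      (nhdsWithin_mono _ fun t (ht : t < 1) => ht.ne)
  refine le_of_tendsto (hslope.mul_const S) ?_
  filter_upwards [Ico_mem_nhdsLT (zero_lt_one (α := ℝ))] with t ht
  have ht1 : 0 < 1 - t := by linarith [ht.2]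
  have hquot : slope (fun t : ℝ => t ^ p) 1 t = (1 - t ^ p) / (1 - t) := by
    rw [slope_def_field, Real.one_rpow, ← neg_div_neg_eq, neg_sub, neg_sub]
  rw [hquot, div_mul_eq_mul_div, div_le_iff₀ ht1]
  linarith [h t ht]

/-- In a product of proper spaces, the sublevel sets of `z ↦ ∑ i, d(x i, z i)^p` are compact. -/
theorem isCompact_setOf_sum_dist_rpow_le {ι X : Type*} [Fintype ι] [MetricSpace X] [ProperSpace X]
    {p : ℝ} (hp : 0 < p) (x : ι → X) (R : ℝ) :
    IsCompact {z : ι → X | ∑ i, dist (x i) (z i) ^ p ≤ R} := by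
  have hcont : Continuous fun z : ι → X => ∑ i, dist (x i) (z i) ^ p :=
    continuous_finsetSum _ fun i _ =>
      (continuous_const.dist (continuous_apply i)).rpow_const fun _ => Or.inr hp.le
  rcases lt_or_ge R 0 with hR | hR
  · convert isCompact_empty
    refine eq_empty_of_forall_notMem fun z hz => hR.not_ge (le_trans ?_ hz)
    positivity
  refine (isCompact_closedBall x (R ^ (1 / p))).of_isClosed_subset
    (isClosed_le hcont continuous_const) fun z hz => ?_
  rw [Metric.mem_closedBall, dist_pi_le_iff (by positivity)]
  intro i
  have hi : dist (x i) (z i) ^ p ≤ R :=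
    (Finset.single_le_sum (f := fun i => dist (x i) (z i) ^ p)
      (fun _ _ => by positivity) (Finset.mem_univ i)).trans hz
  rw [dist_comm, one_div]
  exact (Real.le_rpow_inv_iff_of_pos dist_nonneg hR hp).2 hi

/-- At a maximizer of `y ↦ f y - ∑ i, d(x i, y i)^p`, moving towards `x` along geodesics improves
the trivial bound by a factor `p`. -/
theorem IsGeodesicSpace.mul_sum_dist_rpow_le {ι X : Type*} [Fintype ι] [MetricSpace X]
    (hX : IsGeodesicSpace X) {p L : ℝ} (hp : 0 < p) {f : (ι → X) → ℝ}
    (hLip : ∀ x y : ι → X, |f x - f y| ≤ L * (∑ i, dist (x i) (y i) ^ p) ^ (1 / p))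
    {x y : ι → X}
    (hy : ∀ z : ι → X, f z - ∑ i, dist (x i) (z i) ^ p ≤ f y - ∑ i, dist (x i) (y i) ^ p) :
    p * ∑ i, dist (x i) (y i) ^ p ≤ L * (∑ i, dist (x i) (y i) ^ p) ^ (1 / p) := by
  choose γ hγ0 hγ1 hγ using fun i => hX (x i) (y i)
  refine mul_le_of_forall_mul_one_sub_rpow_le fun t ht => ?_
  have ht1 : 0 ≤ 1 - t := by linarith [ht.2]
  have htI : t ∈ Icc (0 : ℝ) 1 := ⟨ht.1, ht.2.le⟩
  have hleft (i) : dist (x i) (γ i t) = t * dist (x i) (y i) := by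
    have := hγ i 0 (by simp) t htI
    rwa [hγ0, zero_sub, abs_neg, abs_of_nonneg ht.1] at this
  have hright (i) : dist (y i) (γ i t) = (1 - t) * dist (x i) (y i) := by
    have := hγ i 1 (by simp) t htI
    rwa [hγ1, abs_of_nonneg ht1] at this
  have hmax := hy fun i => γ i t
  have hdiff := (le_abs_self _).trans (hLip y fun i => γ i t)
  simp only [hleft, hright, Real.mul_rpow ht.1 dist_nonneg, Real.mul_rpow ht1 dist_nonneg,
    ← Finset.mul_sum] at hmax hdiff
  rw [Real.mul_rpow (by positivity) (by positivity), ← Real.rpow_mul ht1,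
    mul_one_div_cancel hp.ne', Real.rpow_one] at hdiff
  linarith

theorem maximizer_in_ball
    {X : Type*} [MetricSpace X] [CompleteSpace X] [TopologicalSpace.SeparableSpace X]
    [ProperSpace X]
    (p : ℝ) (hp : 1 < p) (n : ℕ) (hn : 0 < n) (L : ℝ) (hL : 0 < L)
    (f : (Fin n → X) → ℝ) (hfc : Continuous f) (hfb : IsBoundedFun f)
    (hLip : ∀ x y : Fin n → X, |f x - f y| ≤ L * (∑ i, dist (x i) (y i) ^ p) ^ (1 / p))
    (x : Fin n → X) :
    (∃ y : Fin n → X,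
      (∀ z : Fin n → X,
        f z - ∑ i, dist (x i) (z i) ^ p ≤ f y - ∑ i, dist (x i) (y i) ^ p) ∧
      ∑ i, dist (x i) (y i) ^ p ≤ L ^ (p / (p - 1))) ∧
    (IsGeodesicSpace X → ∃ y : Fin n → X,
      (∀ z : Fin n → X,
        f z - ∑ i, dist (x i) (z i) ^ p ≤ f y - ∑ i, dist (x i) (y i) ^ p) ∧
      ∑ i, dist (x i) (y i) ^ p ≤ (L / p) ^ (p / (p - 1))) := by
  have hp0 : 0 < p := by linarith
  have hS0 (z : Fin n → X) : 0 ≤ ∑ i, dist (x i) (z i) ^ p := by positivity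
  have hSx : ∑ i, dist (x i) (x i) ^ p = 0 := by simp [Real.zero_rpow hp0.ne']
  have hball (z : Fin n → X) (hz : f x ≤ f z - ∑ i, dist (x i) (z i) ^ p) :
      ∑ i, dist (x i) (z i) ^ p ≤ L ^ (p / (p - 1)) := by
    have hdiff := (neg_le_abs _).trans (hLip x z)
    simpa using le_rpow_conjExponent_of_mul_le hp one_pos hL.le (hS0 z) (by linarith)
  have hcont : Continuous fun z : Fin n → X => f z - ∑ i, dist (x i) (z i) ^ p :=
    hfc.sub <| continuous_finsetSum _ fun i _ =>
      (continuous_const.dist (continuous_apply i)).rpow_const fun _ => Or.inr hp0.le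
  obtain ⟨y, hyK, hy⟩ := (isCompact_setOf_sum_dist_rpow_le hp0 x (L ^ (p / (p - 1)))).exists_isMaxOn
    ⟨x, by rw [mem_ofPred_eq, hSx]; positivity⟩ hcont.continuousOn
  have hxy : f x ≤ f y - ∑ i, dist (x i) (y i) ^ p := by
    have := hball x (by rw [hSx, sub_zero])
    simpa only [mem_ofPred_eq, hSx, sub_zero] using hy this
  have hmax (z : Fin n → X) :
      f z - ∑ i, dist (x i) (z i) ^ p ≤ f y - ∑ i, dist (x i) (y i) ^ p := by
    by_cases hz : f x ≤ f z - ∑ i, dist (x i) (z i) ^ p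
    · exact hy (hball z hz)
    · exact (not_le.1 hz).le.trans hxy
  exact ⟨⟨y, hmax, hyK⟩, fun hX => ⟨y, hmax, le_rpow_conjExponent_of_mul_le hp hp0 hL.le (hS0 y)
    (hX.mul_sum_dist_rpow_le hp0 hLip hmax)⟩⟩
end
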